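/- Suppose |S| = q + 2 (so t = k − 3), p + 1 ≤ k ≤ 2p − 2, and set n = k − p and M = {1, …, n}. Let X = (x_1, …, x_n), Y = (y_1, …, y_n), L (of size p − 1), E (of size 2p − k − 2) and W = (w_1, …, w_{2n}) be pairwise disjoint ordered subsequences of S, and write W_j = {w_1, …, w_j}. Then for every integer r with 0 ≤ r ≤ n: 0 = ∑_{τ ⊆ M} (−1)^{|τ| + σ(X_τ, X)} P_{L ∪ X_{M \ τ}}(Y_τ, X_τ) · ∏_{i=1}^{r} det(y_{n+1−i}, X_{M \ τ}, Y_τ, L) · ∏_{z ∈ E ∪ X_τ ∪ Y_{M \ τ} ∪ W_{n+r}} det(z, X_{M \ τ}, Y_τ, L)^{−1}, where X_τ = (x_i : i ∈ τ) and Y_τ = (y_i : i ∈ τ) with indices in increasing order. -/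

import Mathlib

/-- `detCols L` is the determinant of the `k × k` matrix whose `j`-th column is the
`j`-th entry of the list `L` (lists of length ≠ `k` are padded with `0`). -/
def detCols {F : Type} [CommRing F] {k : ℕ} (L : List (Fin k → F)) : F :=
  Matrix.det (Matrix.of fun i j : Fin k => L.getD (j : ℕ) 0 i)

/-- The Segre product `P_D(A, B)` of the sequences `A = (a_1, …, a_n)` and
`B = (b_0, …, b_{n−1})` with base `D`, with respect to the family of tangent functions `T`:
`∏_{i=1}^n T_{D ∪ {a_1,…,a_{i−1},b_i,…,b_{n−1}}}(a_i) ·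
  T_{D ∪ {a_1,…,a_{i−1},b_i,…,b_{n−1}}}(b_{i−1})⁻¹`. -/
def segreP {F : Type} [Field F] [DecidableEq F] {k : ℕ}
    (T : Finset (Fin k → F) → (Fin k → F) → F)
    (D : Finset (Fin k → F)) (A B : List (Fin k → F)) : F :=
  ∏ j ∈ Finset.range A.length,
    (T (D ∪ (A.take j).toFinset ∪ (B.drop (j + 1)).toFinset) (A.getD j 0) *
      (T (D ∪ (A.take j).toFinset ∪ (B.drop (j + 1)).toFinset) (B.getD j 0))⁻¹)

/-- `T` is a family of tangent functions for `S` (with `t` tangent hyperplanes through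
each subset of size `k − 2`): for every `Y ⊆ S` with `|Y| = k − 2` there is a set `Φ` of
`t` pairwise linearly independent linear forms, each vanishing on `Y` and nonzero at every
vector of `S \ Y`, with `T Y = ∏_{α ∈ Φ} α`. -/
def IsTangentFamily {F : Type} [Field F] [DecidableEq F] {k : ℕ} (t : ℕ)
    (S : Finset (Fin k → F)) (T : Finset (Fin k → F) → (Fin k → F) → F) : Prop :=
  ∀ Y : Finset (Fin k → F), Y ⊆ S → Y.card = k - 2 →
    ∃ Φ : Finset ((Fin k → F) →ₗ[F] F),
      Φ.card = t ∧
      (∀ α ∈ Φ, ∀ β ∈ Φ, α ≠ β → ∀ c : F, α ≠ c • β) ∧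
      (∀ α ∈ Φ, ∀ y ∈ Y, α y = 0) ∧
      (∀ α ∈ Φ, ∀ s ∈ S, s ∉ Y → α s ≠ 0) ∧
      (∀ x, T Y x = ∏ α ∈ Φ, α x)

/-- The subsequence of `L` consisting of the entries whose positions lie in `s`,
in their original order (`d` is a default value). -/
def subseq {α : Type} (d : α) (L : List α) (s : Finset ℕ) : List α :=
  ((List.range L.length).filter (fun i => decide (i ∈ s))).map (fun i => L.getD i d)

/-- The subsequence of `L` consisting of the entries whose positions do not lie in `s`,
in their original order (`d` is a default value). -/
def subseqC {α : Type} (d : α) (L : List α) (s : Finset ℕ) : List α :=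
  ((List.range L.length).filter (fun i => decide (i ∉ s))).map (fun i => L.getD i d)

/-- The number of transpositions needed (counted as the number of inversions) to reorder a
list of length `len` so that the entries in positions `s` occupy the last `|s|` positions,
preserving the relative order of the two groups. -/
def invCount (s : Finset ℕ) (len : ℕ) : ℕ :=
  ((Finset.range len ×ˢ Finset.range len).filter
    (fun ij => ij.1 ∈ s ∧ ij.2 ∉ s ∧ ij.1 < ij.2)).card

section Determinants

variable {F : Type} [Field F] {k : ℕ}

theorem detCols_eq_detRowAlternating (l : List (Fin k → F)) :
    detCols l = Matrix.detRowAlternating (fun j : Fin k => l.getD (j : ℕ) 0) := by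
  rw [detCols, ← Matrix.det_transpose]
  rfl

/-- The linear form `z ↦ det (z, l)`. -/
noncomputable def detForm (hk : 0 < k) (l : List (Fin k → F)) : (Fin k → F) →ₗ[F] F :=
  (Matrix.detRowAlternating (n := Fin k) (R := F)).toMultilinearMap.toLinearMap
    (fun j => ((0 : Fin k → F) :: l).getD (j : ℕ) 0) ⟨0, hk⟩

theorem detForm_apply (hk : 0 < k) (l : List (Fin k → F)) (z : Fin k → F) :
    detForm hk l z = detCols (z :: l) := by
  rw [detCols_eq_detRowAlternating, detForm]
  simp only [MultilinearMap.toLinearMap_apply, AlternatingMap.coe_multilinearMap]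
  congr 1
  funext ⟨j, hj⟩
  cases j with
  | zero => simp
  | succ j => simp [Function.update, Fin.ext_iff]

theorem detCols_swap (pre : List (Fin k → F)) (a b : Fin k → F) (post : List (Fin k → F))
    (h : pre.length + 2 ≤ k) :
    detCols (pre ++ a :: b :: post) = -detCols (pre ++ b :: a :: post) := by
  rw [detCols_eq_detRowAlternating, detCols_eq_detRowAlternating]
  have hne : (⟨pre.length, by omega⟩ : Fin k) ≠ ⟨pre.length + 1, by omega⟩ := by simp
  rw [← AlternatingMap.map_swap _ _ hne]
  congr 1
  funext ⟨j, hj⟩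
  simp only [Function.comp_apply, Equiv.swap_apply_def, Fin.mk.injEq]
  split_ifs with h1 h2
  · subst h1; simp
  · subst h2; simp
  · rcases lt_or_ge j pre.length with h3 | h3
    · simp [List.getElem?_append_left h3]
    · obtain ⟨i, rfl⟩ := Nat.exists_eq_add_of_le h3
      match i, h1, h2 with
      | 0, h1, _ => simp at h1
      | 1, _, h2 => simp at h2
      | i + 2, _, _ => simp [List.getElem?_append_right]

theorem detCols_swap_head {l : List (Fin k → F)} (hl : l.length + 2 = k) (a b : Fin k → F) :
    detCols (a :: b :: l) = -detCols (b :: a :: l) := by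
  simpa using detCols_swap [] a b l (by simp; omega)

theorem detCols_eq_zero_of_mem {z : Fin k → F} {l : List (Fin k → F)} (hz : z ∈ l)
    (hl : l.length + 1 ≤ k) : detCols (z :: l) = 0 := by
  obtain ⟨i, hi, rfl⟩ := List.getElem_of_mem hz
  rw [detCols]
  refine Matrix.det_zero_of_column_eq (i := ⟨0, by omega⟩) (j := ⟨i + 1, by omega⟩) (by simp) ?_
  intro j
  simp [hi]

theorem detCols_move (pre : List (Fin k → F)) (a : Fin k → F) (m post : List (Fin k → F))
    (h : pre.length + m.length + 1 ≤ k) :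
    detCols (pre ++ a :: (m ++ post)) = (-1) ^ m.length * detCols (pre ++ (m ++ a :: post)) := by
  induction m generalizing pre with
  | nil => simp
  | cons b m ih =>
    have := ih (pre ++ [b]) (by simp at h ⊢; omega)
    simp only [List.append_assoc, List.cons_append, List.nil_append] at this
    rw [List.cons_append, detCols_swap _ _ _ _ (by simp at h ⊢; omega), this]
    simp [pow_succ]

theorem exists_sign_of_perm {l l' : List (Fin k → F)} (h : l.Perm l') :
    ∃ s : F, s * s = 1 ∧ ∀ pre : List (Fin k → F), pre.length + l.length ≤ k →
      detCols (pre ++ l') = s * detCols (pre ++ l) := by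
  induction h with
  | nil => exact ⟨1, by simp, by simp⟩
  | cons x _ ih =>
    obtain ⟨s, hs, ih⟩ := ih
    refine ⟨s, hs, fun pre hpre => ?_⟩
    have := ih (pre ++ [x]) (by simp at hpre ⊢; omega)
    simpa using this
  | swap x y l =>
    refine ⟨-1, by simp, fun pre hpre => ?_⟩
    rw [detCols_swap _ _ _ _ (by simp at hpre; omega)]
    simp
  | trans h₁ _ ih₁ ih₂ =>
    obtain ⟨s₁, hs₁, ih₁⟩ := ih₁
    obtain ⟨s₂, hs₂, ih₂⟩ := ih₂
    refine ⟨s₂ * s₁, by linear_combination hs₁ * s₂ * s₂ + hs₂, fun pre hpre => ?_⟩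
    rw [ih₂ pre (h₁.length_eq ▸ hpre), ih₁ pre hpre, mul_assoc]

end Determinants

section Arcs

variable {F : Type} [Field F] [DecidableEq F] {k : ℕ}

/-- Every `k`-subset of `S` is a basis of `F ^ k`. -/
def IsVectorArc (S : Finset (Fin k → F)) : Prop :=
  ∀ A ⊆ S, A.card = k →
    LinearIndependent F (fun v : {x // x ∈ A} => (v : Fin k → F)) ∧
      Submodule.span F (A : Set (Fin k → F)) = ⊤

variable {S : Finset (Fin k → F)}

theorem IsVectorArc.detCols_ne_zero (hS : IsVectorArc S) {l : List (Fin k → F)}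
    (hl : l.length = k) (hnd : l.Nodup) (hlS : ∀ v ∈ l, v ∈ S) : detCols l ≠ 0 := by
  have hli := (hS l.toFinset (fun v hv => hlS v (by simpa using hv))
    (by rw [List.toFinset_card_of_nodup hnd, hl])).1
  have hcomp := hli.comp (fun j : Fin k => ⟨l.get (j.cast hl.symm), by simp⟩) (by
    intro i j hij
    have h := hnd.injective_get (a₁ := i.cast hl.symm) (a₂ := j.cast hl.symm)
      (by simpa using hij)
    simpa using h)
  rw [detCols, ← Matrix.det_transpose, ← isUnit_iff_ne_zero, ← Matrix.isUnit_iff_isUnit_det,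
    ← Matrix.linearIndependent_rows_iff_isUnit]
  convert hcomp using 1
  funext j i
  simp [hl]

theorem IsVectorArc.linearMap_ext (hS : IsVectorArc S) {l : List (Fin k → F)}
    (hl : l.length = k) (hnd : l.Nodup) (hlS : ∀ v ∈ l, v ∈ S)
    {α β : (Fin k → F) →ₗ[F] F} (h : ∀ v ∈ l, α v = β v) : α = β := by
  have hsp := (hS l.toFinset (fun v hv => hlS v (by simpa using hv))
    (by rw [List.toFinset_card_of_nodup hnd, hl])).2
  exact LinearMap.ext_on hsp (fun v hv => h v (by simpa using hv))

end Arcs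

theorem exists_potential {α F : Type*} [DecidableEq α] [Field F] (m : ℕ)
    (f : Finset α → α → F) (S : Finset α)
    (hne : ∀ Y ⊆ S, Y.card = m → ∀ a ∈ S, a ∉ Y → f Y a ≠ 0)
    (htri : ∀ D ⊆ S, D.card + 1 = m → ∀ a ∈ S, ∀ b ∈ S, ∀ c ∈ S, a ∉ D → b ∉ D → c ∉ D →
      a ≠ b → b ≠ c → a ≠ c →
      f (insert a D) b * f (insert b D) c * f (insert c D) a =
        f (insert a D) c * f (insert b D) a * f (insert c D) b) :
    ∃ g c : Finset α → F, ∀ Y ⊆ S, Y.card = m → ∀ a ∈ S, a ∉ Y →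
      f Y a = c Y * g (insert a Y) := by
  classical
  induction S using Finset.induction_on with
  | empty => exact ⟨fun _ => 1, fun _ => 1, by simp⟩
  | insert s S hs ih =>
    have hsub : S ⊆ insert s S := Finset.subset_insert s S
    obtain ⟨g₀, c₀, h₀⟩ := ih (fun Y hY hc a ha => hne Y (hY.trans hsub) hc a (hsub ha))
      (fun D hD hc a ha b hb c hcS => htri D (hD.trans hsub) hc a (hsub ha) b (hsub hb) c (hsub hcS))
    let c₁ : Finset α → F := fun Y => if c₀ Y = 0 then 1 else c₀ Y
    have hc₁ : ∀ Y, c₁ Y ≠ 0 := fun Y => by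
      by_cases h : c₀ Y = 0 <;> simp [c₁, h]
    have h₁ : ∀ Y ⊆ S, Y.card = m → ∀ a ∈ S, a ∉ Y → f Y a = c₁ Y * g₀ (insert a Y) := by
      intro Y hY hYm a ha haY
      have h := h₀ Y hY hYm a ha haY
      have h' : c₀ Y ≠ 0 := fun h0 => hne Y (hY.trans hsub) hYm a (hsub ha) haY (by simp [h, h0])
      simp [c₁, h', h]
    let g : Finset α → F := fun C => if s ∈ C then f (C.erase s) s / c₁ (C.erase s) else g₀ C
    let c : Finset α → F := fun Y => if s ∈ Y then
      (if h : ∃ a ∈ S, a ∉ Y then f Y h.choose / g (insert h.choose Y) else 1) else c₁ Y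
    refine ⟨g, c, fun Y hY hYm a ha haY => ?_⟩
    by_cases hsY : s ∈ Y
    · have haS : a ∈ S := (Finset.mem_insert.1 ha).resolve_left (by rintro rfl; exact haY hsY)
      have hex : ∃ a ∈ S, a ∉ Y := ⟨a, haS, haY⟩
      have hc : c Y = f Y hex.choose / g (insert hex.choose Y) := by simp [c, hsY, hex]
      rw [hc]
      obtain ⟨hbS, hbY⟩ := hex.choose_spec
      generalize hex.choose = b at *
      obtain ⟨D, hsD, rfl⟩ : ∃ D, s ∉ D ∧ Y = insert s D :=
        ⟨Y.erase s, by simp, (Finset.insert_erase hsY).symm⟩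
      have hDS : D ⊆ S := fun x hx => (Finset.mem_insert.1 (hY (by simp [hx]))).resolve_left
        (by rintro rfl; exact hsD hx)
      have hDm : D.card + 1 = m := by rw [← hYm, Finset.card_insert_of_notMem hsD]
      have hg : ∀ x, x ∈ S → x ∉ insert s D → g (insert x (insert s D)) =
          f (insert x D) s / c₁ (insert x D) := by
        intro x hx hxD
        have : (insert x (insert s D)).erase s = insert x D := by
          rw [Finset.insert_comm, Finset.erase_insert]
          simp only [Finset.mem_insert, not_or] at hxD ⊢
          exact ⟨Ne.symm hxD.1, hsD⟩
        simp [g, this]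
      have hcard : ∀ x, x ∉ insert s D → (insert x D).card = m := by
        intro x hx
        rw [Finset.card_insert_of_notMem (fun h => hx (by simp [h])), hDm]
      have hfs : ∀ x, x ∈ S → x ∉ insert s D → f (insert x D) s ≠ 0 := by
        intro x hx hxD
        refine hne _ (Finset.insert_subset (hsub hx) (hDS.trans hsub)) (hcard x hxD) s (by simp) ?_
        simp only [Finset.mem_insert, not_or] at hxD ⊢
        exact ⟨Ne.symm hxD.1, hsD⟩
      rw [hg a haS haY, hg b hbS hbY]
      have hca := hc₁ (insert a D)
      have hcb := hc₁ (insert b D)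
      have hfa := hfs a haS haY
      have hfb := hfs b hbS hbY
      by_cases hab : a = b
      · subst hab
        field_simp
      simp only [Finset.mem_insert, not_or] at haY hbY
      have ht := htri D (hDS.trans hsub) hDm a (hsub haS) b (hsub hbS) s (by simp) haY.2 hbY.2 hsD
        hab hbY.1 haY.1
      rw [h₁ (insert a D) (Finset.insert_subset haS hDS) (hcard a (by simp [haY])) b hbS
          (by simp [hbY, Ne.symm hab]),
        h₁ (insert b D) (Finset.insert_subset hbS hDS) (hcard b (by simp [hbY])) a haS
          (by simp [haY, hab]), Finset.insert_comm a b D] at ht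
      have hg0 : g₀ (insert b (insert a D)) ≠ 0 := by
        intro h0
        refine hne (insert a D) (Finset.insert_subset (hsub haS) (hDS.trans hsub))
          (hcard a (by simp [haY])) b (hsub hbS) (by simp [hbY, Ne.symm hab]) ?_
        rw [h₁ (insert a D) (Finset.insert_subset haS hDS) (hcard a (by simp [haY])) b hbS
          (by simp [hbY, Ne.symm hab]), h0, mul_zero]
      field_simp
      apply mul_left_cancel₀ hg0
      rw [Finset.insert_comm b a D] at ht ⊢
      linear_combination ht
    · have hYS : Y ⊆ S := fun x hx => (Finset.mem_insert.1 (hY hx)).resolve_left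
        (by rintro rfl; exact hsY hx)
      have hc : c Y = c₁ Y := by simp [c, hsY]
      rw [hc]
      rcases Finset.mem_insert.1 ha with rfl | haS
      · have : g (insert a Y) = f Y a / c₁ Y := by simp [g, Finset.erase_insert haY]
        rw [this, mul_div_cancel₀ _ (hc₁ Y)]
      · have hsa : s ≠ a := by rintro rfl; exact hs haS
        rw [h₁ Y hYS hYm a haS haY]
        simp [g, hsY, hsa]

section Tangents

variable {F : Type} [Field F] [DecidableEq F] {k : ℕ} {S : Finset (Fin k → F)}

theorem IsVectorArc.sum_prod_forms_eq_zero (hS : IsVectorArc S) {l : List (Fin k → F)}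
    (hl : l.length + 2 = k) (hnd : l.Nodup) (hlS : ∀ v ∈ l, v ∈ S)
    (Φ : Finset ((Fin k → F) →ₗ[F] F)) (hΦ : ∀ α ∈ Φ, ∀ v ∈ l, α v = 0)
    (E : Finset (Fin k → F)) (hES : E ⊆ S) (hEl : ∀ v ∈ E, v ∉ l) (hE : E.card = Φ.card + 2) :
    ∑ a ∈ E, (∏ α ∈ Φ, α a) * ∏ z ∈ E.erase a, (detCols (z :: a :: l))⁻¹ = 0 := by
  classical
  have hk : 0 < k := by omega
  induction Φ using Finset.induction_on generalizing E with
  | empty =>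
    obtain ⟨a, b, hab, rfl⟩ := Finset.card_eq_two.1 (by simpa using hE)
    have h1 : ({a, b} : Finset (Fin k → F)).erase a = {b} := by
      rw [Finset.erase_insert]; simpa using hab
    have h2 : ({a, b} : Finset (Fin k → F)).erase b = {a} := by
      rw [Finset.pair_comm, Finset.erase_insert]; simpa using hab.symm
    rw [Finset.sum_pair hab, h1, h2]
    simp only [Finset.prod_empty, Finset.prod_singleton, one_mul]
    rw [detCols_swap_head hl a b, inv_neg]
    ring
  | insert α Φ hα ih =>
    rw [Finset.card_insert_of_notMem hα] at hE
    have hdet : ∀ a ∈ E, ∀ b ∈ E, a ≠ b → detCols (a :: b :: l) ≠ 0 := fun a ha b hb hab =>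
      hS.detCols_ne_zero (by simp; omega) (by simp [hab, hEl a ha, hEl b hb, hnd])
        (by simpa [hES ha, hES hb] using hlS)
    have key : ∀ e ∈ E, ∑ a ∈ E, (∏ β ∈ Φ, β a) * (detCols (e :: a :: l) *
        ∏ z ∈ E.erase a, (detCols (z :: a :: l))⁻¹) = 0 := by
      intro e he
      rw [← Finset.sum_erase_add _ _ he, detCols_eq_zero_of_mem (z := e) (by simp) (by simp; omega),
        zero_mul, mul_zero, add_zero]
      rw [← ih (fun β hβ => hΦ β (Finset.mem_insert_of_mem hβ)) (E.erase e)
        ((Finset.erase_subset _ _).trans hES) (fun v hv => hEl v (Finset.mem_of_mem_erase hv))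
        (by rw [Finset.card_erase_of_mem he, hE]; omega)]
      refine Finset.sum_congr rfl fun a ha => ?_
      obtain ⟨hae, haE⟩ := Finset.mem_erase.1 ha
      rw [Finset.erase_right_comm (a := e),
        ← Finset.mul_prod_erase (E.erase a) _ (Finset.mem_erase.2 ⟨hae.symm, he⟩),
        mul_inv_cancel_left₀ (hdet e he a haE hae.symm)]
    obtain ⟨e₁, he₁, e₂, he₂, he⟩ := Finset.one_lt_card.1 (show 1 < E.card by omega)
    have hd := hdet e₁ he₁ e₂ he₂ he
    have hform : α = (-(α e₂ / detCols (e₁ :: e₂ :: l)) * -1) • (-1 : F) • detForm hk (e₁ :: l) +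
        (α e₁ / detCols (e₁ :: e₂ :: l)) • detForm hk (e₂ :: l) := by
      refine hS.linearMap_ext (l := e₁ :: e₂ :: l) (by simp; omega)
        (by simp [he, hEl e₁ he₁, hEl e₂ he₂, hnd]) (by simpa [hES he₁, hES he₂] using hlS) ?_
      intro v hv
      simp only [List.mem_cons] at hv
      simp only [LinearMap.add_apply, LinearMap.smul_apply, detForm_apply, smul_eq_mul]
      rcases hv with rfl | rfl | hv
      · rw [detCols_eq_zero_of_mem (z := v) (l := v :: l) (by simp) (by simp; omega)]
        field_simp
        ring
      · rw [detCols_eq_zero_of_mem (z := v) (l := v :: l) (by simp) (by simp; omega),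
          detCols_swap_head hl v e₁]
        field_simp
        ring
      · rw [hΦ α (by simp) v hv,
          detCols_eq_zero_of_mem (z := v) (l := e₁ :: l) (by simp [hv]) (by simp; omega),
          detCols_eq_zero_of_mem (z := v) (l := e₂ :: l) (by simp [hv]) (by simp; omega)]
        ring
    have hα' : ∀ a, α a = α e₂ / detCols (e₁ :: e₂ :: l) * detCols (e₁ :: a :: l) -
        α e₁ / detCols (e₁ :: e₂ :: l) * detCols (e₂ :: a :: l) := by
      intro a
      conv_lhs => rw [hform]
      simp only [LinearMap.add_apply, LinearMap.smul_apply, detForm_apply, smul_eq_mul]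
      rw [detCols_swap_head hl a e₁, detCols_swap_head hl a e₂]
      ring
    have h1 := key e₁ he₁
    have h2 := key e₂ he₂
    calc _ = α e₂ / detCols (e₁ :: e₂ :: l) * ∑ a ∈ E, (∏ β ∈ Φ, β a) * (detCols (e₁ :: a :: l) *
        ∏ z ∈ E.erase a, (detCols (z :: a :: l))⁻¹) - α e₁ / detCols (e₁ :: e₂ :: l) *
        ∑ a ∈ E, (∏ β ∈ Φ, β a) * (detCols (e₂ :: a :: l) *
        ∏ z ∈ E.erase a, (detCols (z :: a :: l))⁻¹) := by
          rw [Finset.mul_sum, Finset.mul_sum, ← Finset.sum_sub_distrib]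
          refine Finset.sum_congr rfl fun a _ => ?_
          rw [Finset.prod_insert hα, hα' a]
          ring
      _ = 0 := by rw [h1, h2]; simp

variable {t : ℕ} {T : Finset (Fin k → F) → (Fin k → F) → F}

theorem IsTangentFamily.ne_zero (hT : IsTangentFamily t S T) {Y : Finset (Fin k → F)}
    (hY : Y ⊆ S) (hc : Y.card = k - 2) {a : Fin k → F} (ha : a ∈ S) (haY : a ∉ Y) :
    T Y a ≠ 0 := by
  obtain ⟨Φ, -, -, -, h, hprod⟩ := hT Y hY hc
  rw [hprod]
  exact Finset.prod_ne_zero_iff.2 fun α hα => h α hα a ha haY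

/-- The values at `y`, relative to `z`, of all hyperplanes through `x` and `D` missing `y` and `z`
run over the nonzero field elements, whose product is `-1`. -/
theorem IsTangentFamily.ratio_mul_prod [Fintype F] (hT : IsTangentFamily t S T)
    (hS : IsVectorArc S) (ht : S.card + t = Fintype.card F + k - 1) (x y z : Fin k → F)
    (D : List (Fin k → F)) (hD : D.length + 3 = k) (hnd : (x :: y :: z :: D).Nodup)
    (hDS : ∀ v ∈ x :: y :: z :: D, v ∈ S) :
    T (insert x D.toFinset) y / T (insert x D.toFinset) z *
      ∏ s ∈ S \ (x :: y :: z :: D).toFinset,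
        detCols (y :: s :: x :: D) / detCols (z :: s :: x :: D) = -1 := by
  classical
  have hk : 0 < k := by omega
  have hnd' := hnd
  simp only [List.nodup_cons, List.mem_cons, not_or] at hnd'
  obtain ⟨⟨hxy, hxz, hxD⟩, ⟨hyz, hyD⟩, hzD, hDnd⟩ := hnd'
  have hxS := hDS x (by simp)
  have hyS := hDS y (by simp)
  have hzS := hDS z (by simp)
  obtain ⟨Φ, hΦt, hΦ, hΦ0, hΦS, hprod⟩ := hT (insert x D.toFinset)
    (fun v hv => hDS v (by simp at hv ⊢; tauto))
    (by rw [Finset.card_insert_of_notMem (by simpa using hxD), List.toFinset_card_of_nodup hDnd]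
        omega)
  have hprop : ∀ α β : (Fin k → F) →ₗ[F] F, (∀ v ∈ x :: D, α v = 0) → (∀ v ∈ x :: D, β v = 0) →
      α z ≠ 0 → β z ≠ 0 → α y / α z = β y / β z → α = (α z / β z) • β := by
    intro α β hα hβ hαz hβz hr
    refine hS.linearMap_ext (l := x :: y :: z :: D) (by simp; omega) hnd hDS ?_
    intro v hv
    simp only [LinearMap.smul_apply, smul_eq_mul]
    simp only [List.mem_cons] at hv
    rcases hv with rfl | rfl | rfl | hv
    · rw [hα v (by simp), hβ v (by simp), mul_zero]
    · field_simp at hr ⊢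
      linear_combination hr
    · field_simp
    · rw [hα v (by simp [hv]), hβ v (by simp [hv]), mul_zero]
  set S' := S \ (x :: y :: z :: D).toFinset with hS'
  have hS'm : ∀ s ∈ S', s ∈ S ∧ s ≠ x ∧ s ≠ y ∧ s ≠ z ∧ s ∉ D := by
    intro s hs
    simpa [hS', not_or] using hs
  have hdet : ∀ s ∈ S', ∀ v ∈ S, v ≠ s → v ∉ x :: D → detCols (v :: s :: x :: D) ≠ 0 := by
    intro s hs v hv hvs hvD
    obtain ⟨h1, h2, h3, h4, h5⟩ := hS'm s hs
    refine hS.detCols_ne_zero (by simp; omega) ?_ ?_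
    · simp only [List.mem_cons, not_or] at hvD
      simp [hvs, hvD, h2, h5, hxD, hDnd]
    · intro w hw
      simp only [List.mem_cons] at hw
      rcases hw with rfl | rfl | rfl | hw
      exacts [hv, h1, hxS, hDS w (by simp [hw])]
  have hγ0 : ∀ s, ∀ v ∈ s :: x :: D, detForm hk (s :: x :: D) v = 0 := by
    intro s v hv
    rw [detForm_apply]
    exact detCols_eq_zero_of_mem hv (by simp; omega)
  have hγ : ∀ s ∈ S', ∀ v ∈ S, v ≠ s → v ∉ x :: D → detForm hk (s :: x :: D) v ≠ 0 := by
    intro s hs v hv hvs hvD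
    rw [detForm_apply]
    exact hdet s hs v hv hvs hvD
  have hyD' : y ∉ x :: D := by simp [hyD, Ne.symm hxy]
  have hzD' : z ∉ x :: D := by simp [hzD, Ne.symm hxz]
  have hΦ0' : ∀ α ∈ Φ, ∀ v ∈ x :: D, α v = 0 := fun α hα v hv => hΦ0 α hα v (by simpa using hv)
  have hΦS' : ∀ α ∈ Φ, ∀ v ∈ S, v ∉ x :: D → α v ≠ 0 :=
    fun α hα v hv hvD => hΦS α hα v hv (by simpa using hvD)
  have inj1 : Set.InjOn (fun α : (Fin k → F) →ₗ[F] F => α y / α z) Φ := by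
    intro α hα β hβ hr
    by_contra hne
    exact hΦ α hα β hβ hne _ (hprop α β (hΦ0' α hα) (hΦ0' β hβ) (hΦS' α hα z hzS hzD')
      (hΦS' β hβ z hzS hzD') hr)
  have inj2 : Set.InjOn (fun s => detCols (y :: s :: x :: D) / detCols (z :: s :: x :: D)) S' := by
    intro s hs s' hs' hr
    by_contra hne
    simp only [← detForm_apply hk] at hr
    have h := hprop _ _ (fun v hv => hγ0 s v (by simp at hv ⊢; tauto))
      (fun v hv => hγ0 s' v (by simp at hv ⊢; tauto))
      (hγ s hs z hzS (Ne.symm (hS'm s hs).2.2.2.1) hzD')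
      (hγ s' hs' z hzS (Ne.symm (hS'm s' hs').2.2.2.1) hzD') hr
    have h2 := congrArg (fun α => α s') h
    simp only [LinearMap.smul_apply, smul_eq_mul] at h2
    rw [hγ0 s' s' (by simp), mul_zero] at h2
    obtain ⟨h3, h4, -, -, h5⟩ := hS'm s' hs'
    exact hγ s hs s' h3 (Ne.symm hne) (by simp [h4, h5]) h2
  have hdisj : Disjoint (Φ.image fun α => α y / α z)
      (S'.image fun s => detCols (y :: s :: x :: D) / detCols (z :: s :: x :: D)) := by
    rw [Finset.disjoint_left]
    intro c hc1 hc2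
    obtain ⟨α, hα, rfl⟩ := Finset.mem_image.1 hc1
    obtain ⟨s, hs, hr⟩ := Finset.mem_image.1 hc2
    simp only [← detForm_apply hk] at hr
    have h := hprop _ _ (hΦ0' α hα) (fun v hv => hγ0 s v (by simp at hv ⊢; tauto))
      (hΦS' α hα z hzS hzD') (hγ s hs z hzS (Ne.symm (hS'm s hs).2.2.2.1) hzD') hr.symm
    have h2 := congrArg (fun α => α s) h
    simp only [LinearMap.smul_apply, smul_eq_mul] at h2
    rw [hγ0 s s (by simp), mul_zero] at h2
    obtain ⟨h3, h4, -, -, h5⟩ := hS'm s hs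
    exact hΦS' α hα s h3 (by simp [h4, h5]) h2
  have hunion : (Φ.image fun α => α y / α z) ∪
      (S'.image fun s => detCols (y :: s :: x :: D) / detCols (z :: s :: x :: D)) =
      Finset.univ.erase 0 := by
    refine Finset.eq_of_subset_of_card_le ?_ ?_
    · intro c hc
      rw [Finset.mem_erase]
      refine ⟨?_, Finset.mem_univ _⟩
      rcases Finset.mem_union.1 hc with hc | hc
      · obtain ⟨α, hα, rfl⟩ := Finset.mem_image.1 hc
        exact div_ne_zero (hΦS' α hα y hyS hyD') (hΦS' α hα z hzS hzD')
      · obtain ⟨s, hs, rfl⟩ := Finset.mem_image.1 hc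
        exact div_ne_zero (hdet s hs y hyS (Ne.symm (hS'm s hs).2.2.1) hyD')
          (hdet s hs z hzS (Ne.symm (hS'm s hs).2.2.2.1) hzD')
    · rw [Finset.card_union_of_disjoint hdisj, Finset.card_image_of_injOn inj1,
        Finset.card_image_of_injOn inj2, hΦt, hS', Finset.card_sdiff_of_subset
          (fun v hv => hDS v (by simpa using hv)), List.toFinset_card_of_nodup hnd,
        Finset.card_erase_of_mem (Finset.mem_univ _), Finset.card_univ]
      simp only [List.length_cons]
      omega
  have hunits : ∏ c ∈ (Finset.univ : Finset F).erase 0, c = -1 := by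
    have h := congrArg (Units.val) (FiniteField.prod_univ_units_id_eq_neg_one (K := F))
    rw [Units.coe_prod] at h
    rw [← Units.val_one, ← Units.val_neg, ← h]
    refine (Finset.prod_bij (fun (u : Fˣ) _ => (u : F)) ?_ ?_ ?_ ?_).symm
    · simp
    · intro a _ b _ hab; exact Units.ext hab
    · intro c hc
      exact ⟨Units.mk0 c (by simpa using hc), by simp, rfl⟩
    · simp
  rw [← hunits, ← hunion, Finset.prod_union hdisj, Finset.prod_image inj1, Finset.prod_image inj2,
    hprod, hprod, Finset.prod_div_distrib (s := Φ)]

/-- Segre's lemma of tangents. -/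
theorem IsTangentFamily.segre [Fintype F] (hT : IsTangentFamily t S T)
    (hS : IsVectorArc S) (ht : S.card + t = Fintype.card F + k - 1) (hSk : k ≤ S.card)
    (x y z : Fin k → F)
    (D : List (Fin k → F)) (hD : D.length + 3 = k) (hnd : (x :: y :: z :: D).Nodup)
    (hDS : ∀ v ∈ x :: y :: z :: D, v ∈ S) :
    T (insert x D.toFinset) y * T (insert y D.toFinset) z * T (insert z D.toFinset) x =
      (-1) ^ (t + 1) *
      (T (insert x D.toFinset) z * T (insert y D.toFinset) x * T (insert z D.toFinset) y) := by
  have hcyc : ∀ a b c : Fin k → F, (a :: b :: c :: D).Perm (b :: c :: a :: D) := fun a b c =>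
    (List.Perm.swap b a _).trans ((List.Perm.swap c a _).cons b)
  have hset : ∀ a b c : Fin k → F, (b :: c :: a :: D).toFinset = (a :: b :: c :: D).toFinset :=
    fun a b c => (List.toFinset_eq_of_perm _ _ (hcyc a b c)).symm
  have h1 := hT.ratio_mul_prod hS ht x y z D hD hnd hDS
  have hnd2 := (hcyc x y z).nodup_iff.1 hnd
  have hDS2 : ∀ v ∈ y :: z :: x :: D, v ∈ S := fun v hv => hDS v ((hcyc x y z).mem_iff.2 hv)
  have h2 := hT.ratio_mul_prod hS ht y z x D hD hnd2 hDS2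
  have hnd3 := (hcyc y z x).nodup_iff.1 hnd2
  have hDS3 : ∀ v ∈ z :: x :: y :: D, v ∈ S := fun v hv => hDS2 v ((hcyc y z x).mem_iff.2 hv)
  have h3 := hT.ratio_mul_prod hS ht z x y D hD hnd3 hDS3
  rw [hset y z x, hset x y z] at h3
  rw [hset x y z] at h2
  set S' := S \ (x :: y :: z :: D).toFinset with hS'
  have hcard : S'.card = S.card - k := by
    rw [hS', Finset.card_sdiff_of_subset (fun v hv => hDS v (by simpa using hv)),
      List.toFinset_card_of_nodup hnd]
    simp only [List.length_cons]
    omega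
  have hnd' := hnd
  simp only [List.nodup_cons, List.mem_cons, not_or] at hnd'
  obtain ⟨⟨hxy, hxz, hxD⟩, ⟨hyz, hyD⟩, hzD, hDnd⟩ := hnd'
  have hxS := hDS x (by simp)
  have hyS := hDS y (by simp)
  have hzS := hDS z (by simp)
  have hT0 : ∀ a ∈ S, ∀ b ∈ S, a ≠ b → a ∉ D → b ∉ D → T (insert a D.toFinset) b ≠ 0 := by
    intro a ha b hb hab haD hbD
    refine hT.ne_zero ?_ ?_ hb (by simp [hbD, hab.symm])
    · exact Finset.insert_subset ha (fun v hv => hDS v (by simp at hv; simp [hv]))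
    · rw [Finset.card_insert_of_notMem (by simpa using haD), List.toFinset_card_of_nodup hDnd]
      omega
  have hprod : (∏ s ∈ S', detCols (y :: s :: x :: D) / detCols (z :: s :: x :: D)) *
      (∏ s ∈ S', detCols (z :: s :: y :: D) / detCols (x :: s :: y :: D)) *
      (∏ s ∈ S', detCols (x :: s :: z :: D) / detCols (y :: s :: z :: D)) =
      (-1) ^ (S.card - k) := by
    rw [← Finset.prod_mul_distrib, ← Finset.prod_mul_distrib, ← hcard, ← Finset.prod_const]
    refine Finset.prod_congr rfl fun s hs => ?_
    have hs' : s ∈ S ∧ s ≠ x ∧ s ≠ y ∧ s ≠ z ∧ s ∉ D := by simpa [hS', not_or] using hs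
    obtain ⟨h0, h4, h5, h6, h7⟩ := hs'
    have hdet : ∀ a ∈ S, ∀ b ∈ S, a ≠ b → a ∉ D → b ∉ D → s ≠ a → s ≠ b →
        detCols (a :: s :: b :: D) ≠ 0 := by
      intro a ha b hb hab haD hbD hsa hsb
      refine hS.detCols_ne_zero (by simp; omega) ?_ ?_
      · simp [hab, haD, hbD, hsa.symm, hsb, h7, hDnd]
      · intro w hw
        simp only [List.mem_cons] at hw
        rcases hw with rfl | rfl | rfl | hw
        exacts [ha, h0, hb, hDS w (by simp [hw])]
    have hsw : ∀ a b, detCols (a :: s :: b :: D) = -detCols (b :: s :: a :: D) := by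
      intro a b
      rw [detCols_swap_head (by simp; omega) a s]
      have h8 := detCols_swap [s] a b D (by simp; omega)
      simp only [List.cons_append, List.nil_append] at h8
      rw [h8, detCols_swap_head (by simp; omega) s b, neg_neg]
    have e1 := hdet z hzS x hxS (Ne.symm hxz) hzD hxD h6 h4
    have e2 := hdet x hxS y hyS hxy hxD hyD h4 h5
    have e3 := hdet y hyS z hzS hyz hyD hzD h5 h6
    rw [hsw y x, hsw z y, hsw x z]
    field_simp
  have e1 := hT0 x hxS z hzS hxz hxD hzD
  have e2 := hT0 y hyS x hxS (Ne.symm hxy) hyD hxD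
  have e3 := hT0 z hzS y hyS (Ne.symm hyz) hzD hyD
  have hsign : (-1 : F) ^ (S.card - k) * (-1) ^ (t + 1) = -1 := by
    rw [← pow_add, show S.card - k + (t + 1) = Fintype.card F by omega, FiniteField.pow_card]
  have hsq : ((-1 : F) ^ (t + 1)) * (-1) ^ (t + 1) = 1 := by
    rw [← mul_pow]; simp
  have hall : T (insert x D.toFinset) y / T (insert x D.toFinset) z *
      (T (insert y D.toFinset) z / T (insert y D.toFinset) x) *
      (T (insert z D.toFinset) x / T (insert z D.toFinset) y) * (-1) ^ (S.card - k) = -1 := by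
    rw [← hprod]
    linear_combination h1 * (T (insert y D.toFinset) z / T (insert y D.toFinset) x *
      ∏ s ∈ S', detCols (z :: s :: y :: D) / detCols (x :: s :: y :: D)) *
      (T (insert z D.toFinset) x / T (insert z D.toFinset) y *
      ∏ s ∈ S', detCols (x :: s :: z :: D) / detCols (y :: s :: z :: D)) - h2 *
      (T (insert z D.toFinset) x / T (insert z D.toFinset) y *
      ∏ s ∈ S', detCols (x :: s :: z :: D) / detCols (y :: s :: z :: D)) + h3
  have hneg : T (insert x D.toFinset) y / T (insert x D.toFinset) z *
      (T (insert y D.toFinset) z / T (insert y D.toFinset) x) *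
      (T (insert z D.toFinset) x / T (insert z D.toFinset) y) = (-1) ^ (t + 1) := by
    linear_combination -(-1) ^ (t + 1) * hall + (T (insert x D.toFinset) y /
      T (insert x D.toFinset) z * (T (insert y D.toFinset) z / T (insert y D.toFinset) x) *
      (T (insert z D.toFinset) x / T (insert z D.toFinset) y)) * hsign
  rw [← hneg]
  field_simp

/-- `G` is a function of ordered `(k - 1)`-sequences, scaling like the `(t + 1)`-st power of a
determinant under permutations, whose ratios recover those of the tangent functions. -/
structure IsScaling (t : ℕ) (S : Finset (Fin k → F))
    (T : Finset (Fin k → F) → (Fin k → F) → F) (G : List (Fin k → F) → F) : Prop where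
  perm : ∀ (l l' : List (Fin k → F)) (s : F), l.Perm l' →
    (∀ z, detCols (z :: l') = s * detCols (z :: l)) → G l' = s ^ (t + 1) * G l
  tangent : ∀ l : List (Fin k → F), l.length + 2 = k → l.Nodup → (∀ v ∈ l, v ∈ S) →
    ∃ c, ∀ a ∈ S, a ∉ l → T l.toFinset a = c * G (a :: l)

/-- Rescaling the tangent functions turns them into a single function of `k - 1` points of `S`
which is symmetric or alternating according to the parity of `t + 1`. -/
theorem IsTangentFamily.exists_isScaling [Fintype F] (hT : IsTangentFamily t S T)
    (hS : IsVectorArc S) (ht : S.card + t = Fintype.card F + k - 1) (hSk : k ≤ S.card)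
    (hk : 3 ≤ k) :
    ∃ G : List (Fin k → F) → F, IsScaling t S T G := by
  classical
  have hzc : ∀ C : Finset (Fin k → F), ∃ z, C ⊆ S → C.card + 1 = k → z ∈ S ∧ z ∉ C := by
    intro C
    by_cases h : C ⊆ S ∧ C.card + 1 = k
    · obtain ⟨z, hz, hz'⟩ := Finset.exists_mem_notMem_of_card_lt_card (show C.card < S.card by omega)
      exact ⟨z, fun _ _ => ⟨hz, hz'⟩⟩
    · exact ⟨0, fun h1 h2 => absurd ⟨h1, h2⟩ h⟩
  choose zc hzc using hzc
  have hdet : ∀ l : List (Fin k → F), l.length + 1 = k → l.Nodup → (∀ v ∈ l, v ∈ S) →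
      detCols (zc l.toFinset :: l) ≠ 0 := by
    intro l hl hnd hlS
    obtain ⟨h1, h2⟩ := hzc l.toFinset (fun v hv => hlS v (by simpa using hv))
      (by rw [List.toFinset_card_of_nodup hnd, hl])
    exact hS.detCols_ne_zero (by simpa using hl) (by simpa [hnd] using h2)
      (by simpa [h1] using hlS)
  let f : Finset (Fin k → F) → (Fin k → F) → F := fun Y a =>
    T Y a / detCols (zc (insert a Y) :: a :: Y.toList) ^ (t + 1)
  obtain ⟨g, c, hgc⟩ := exists_potential (k - 2) f S
    (by
      intro Y hY hYc a ha haY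
      refine div_ne_zero (hT.ne_zero hY hYc ha haY) (pow_ne_zero _ ?_)
      have h := hdet (a :: Y.toList) (by simp; omega) (by simp [haY, Finset.nodup_toList])
        (by intro v hv; simp at hv; rcases hv with rfl | hv; exacts [ha, hY hv])
      simpa using h)
    (by
      intro D hD hDc a ha b hb c hc haD hbD hcD hab hbc hac
      have hlen : D.toList.length + 3 = k := by simp; omega
      have hnd : (a :: b :: c :: D.toList).Nodup := by
        simp [hab, hac, haD, hbc, hbD, hcD, Finset.nodup_toList]
      have hin : ∀ v ∈ a :: b :: c :: D.toList, v ∈ S := by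
        intro v hv
        simp only [List.mem_cons, Finset.mem_toList] at hv
        rcases hv with rfl | rfl | rfl | hv
        exacts [ha, hb, hc, hD hv]
      have hseg := hT.segre hS ht hSk a b c D.toList hlen hnd hin
      rw [Finset.toList_toFinset] at hseg
      have hsg : ∀ x, x ∉ D → ∃ s : F, s * s = 1 ∧ ∀ z y,
          detCols (z :: y :: (insert x D).toList) = s * detCols (z :: y :: x :: D.toList) := by
        intro x hx
        obtain ⟨s, hs, h⟩ := exists_sign_of_perm (k := k) (Finset.toList_insert hx).symm
        refine ⟨s, hs, fun z y => ?_⟩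
        have := h [z, y] (by simp at hlen ⊢; omega)
        simpa using this
      obtain ⟨sa, hsa, ha'⟩ := hsg a haD
      obtain ⟨sb, hsb, hb'⟩ := hsg b hbD
      obtain ⟨sc, hsc, hc'⟩ := hsg c hcD
      have hsw : ∀ z x y, detCols (z :: x :: y :: D.toList) =
          -detCols (z :: y :: x :: D.toList) := by
        intro z x y
        have h := detCols_swap [z] x y D.toList (by simp at hlen ⊢; omega)
        simpa using h
      have hd : ∀ x y, x ∈ S → y ∈ S → x ∉ D → y ∉ D → x ≠ y →
          detCols (zc (insert x (insert y D)) :: x :: y :: D.toList) ≠ 0 := by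
        intro x y hx hy hxD hyD hxy
        have h := hdet (x :: y :: D.toList) (by simp at hlen ⊢; omega)
          (by simp [hxy, hxD, hyD, Finset.nodup_toList])
          (by
            intro v hv
            simp only [List.mem_cons, Finset.mem_toList] at hv
            rcases hv with rfl | rfl | hv
            exacts [hx, hy, hD hv])
        simpa using h
      have h1 := hd a b ha hb haD hbD hab
      have h2 := hd b c hb hc hbD hcD hbc
      have h3 := hd a c ha hc haD hcD hac
      have hsa0 : sa ≠ 0 := left_ne_zero_of_mul_eq_one hsa
      have hsb0 : sb ≠ 0 := left_ne_zero_of_mul_eq_one hsb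
      have hsc0 : sc ≠ 0 := left_ne_zero_of_mul_eq_one hsc
      simp only [f, ha', hb', hc']
      rw [Finset.insert_comm b a, Finset.insert_comm c b, Finset.insert_comm c a, hsw _ b a,
        hsw _ c b, hsw _ c a]
      have hsq : ((-1 : F) ^ (t + 1)) * (-1) ^ (t + 1) = 1 := by
        rw [← mul_pow]; simp
      have hn : ((-1 : F) ^ (t + 1)) ≠ 0 := left_ne_zero_of_mul_eq_one hsq
      simp only [← neg_one_mul (detCols _), mul_pow]
      field_simp
      linear_combination hseg)
  refine ⟨fun l => g l.toFinset * detCols (zc l.toFinset :: l) ^ (t + 1), ⟨?_, ?_⟩⟩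
  · intro l l' s hp hs
    simp only [← List.toFinset_eq_of_perm _ _ hp, hs]
    ring
  · intro l hl hnd hlS
    obtain ⟨s, hs, h⟩ := exists_sign_of_perm (k := k) (List.toFinset_toList hnd)
    have hs0 : s ≠ 0 := left_ne_zero_of_mul_eq_one hs
    refine ⟨c l.toFinset * s ^ (t + 1), fun a ha hal => ?_⟩
    have h1 := hgc l.toFinset (fun v hv => hlS v (by simpa using hv))
      (by rw [List.toFinset_card_of_nodup hnd]; omega) a ha (by simpa using hal)
    have h2 := hdet (a :: l) (by simp; omega) (by simp [hal, hnd]) (by simpa [ha] using hlS)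
    have h3 := h [zc (insert a l.toFinset), a] (by simp; rw [List.toFinset_card_of_nodup hnd]; omega)
    simp only [List.cons_append, List.nil_append] at h3
    simp only [List.toFinset_cons] at h2 ⊢
    rw [h3] at h2 ⊢
    have h4 : detCols (zc (insert a l.toFinset) :: a :: l.toFinset.toList) ≠ 0 :=
      right_ne_zero_of_mul h2
    simp only [f] at h1
    rw [div_eq_iff (pow_ne_zero _ h4)] at h1
    rw [h1, mul_pow]
    have hss : s ^ (t + 1) * s ^ (t + 1) = 1 := by rw [← mul_pow, hs, one_pow]
    linear_combination (-c l.toFinset * g (insert a l.toFinset) *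
      detCols (zc (insert a l.toFinset) :: a :: l.toFinset.toList) ^ (t + 1)) * hss

end Tangents

section Inclusion

variable {α F : Type*} [DecidableEq α] [Field F]

/-- The sum of `h` over the `m`-subsets of `Z` which contain `A` and avoid `B`. -/
def inclusionSum (h : Finset α → F) (Z : Finset α) (m : ℕ) (A B : Finset α) : F :=
  ∑ C ∈ Z.powersetCard m with A ⊆ C ∧ Disjoint B C, h C

variable {h : Finset α → F} {Z : Finset α} {m : ℕ}

theorem sum_inclusionSum_insert {A : Finset α} {j : ℕ} (hj : A.card + j = m) :
    ∑ a ∈ Z \ A, inclusionSum h Z m (insert a A) ∅ = j * inclusionSum h Z m A ∅ := by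
  simp only [inclusionSum, Finset.sum_filter]
  rw [Finset.sum_comm, Finset.mul_sum]
  refine Finset.sum_congr rfl fun C hC => ?_
  obtain ⟨hCZ, hCm⟩ := Finset.mem_powersetCard.1 hC
  by_cases hAC : A ⊆ C
  · have hcard : ((Z \ A).filter (fun a => a ∈ C)).card = j := by
      have : (Z \ A).filter (fun a => a ∈ C) = C \ A := by
        ext a
        simp only [Finset.mem_filter, Finset.mem_sdiff]
        constructor
        · rintro ⟨⟨-, h2⟩, h3⟩; exact ⟨h3, h2⟩
        · rintro ⟨h3, h2⟩; exact ⟨⟨hCZ h3, h2⟩, h3⟩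
      rw [this, Finset.card_sdiff_of_subset hAC]
      omega
    simp only [Finset.insert_subset_iff, hAC, and_true, Finset.disjoint_empty_left, if_true]
    rw [← Finset.sum_filter, Finset.sum_const, hcard, nsmul_eq_mul]
  · have : ∀ a, ¬ insert a A ⊆ C := fun a ha => hAC ((Finset.subset_insert a A).trans ha)
    simp [this, hAC]

theorem inclusionSum_of_card_eq {A : Finset α} (hA : A ⊆ Z) (hm : A.card = m) :
    inclusionSum h Z m A ∅ = h A := by
  rw [inclusionSum, show (Z.powersetCard m).filter (fun C => A ⊆ C ∧ Disjoint ∅ C) = {A} from ?_,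
    Finset.sum_singleton]
  ext C
  simp only [Finset.mem_filter, Finset.mem_powersetCard, Finset.mem_singleton,
    Finset.disjoint_empty_left, and_true]
  constructor
  · rintro ⟨⟨-, h2⟩, h3⟩
    exact (Finset.eq_of_subset_of_card_le h3 (by omega)).symm
  · rintro rfl
    exact ⟨⟨hA, hm⟩, subset_rfl⟩

theorem inclusionSum_insert_right (A B : Finset α) (b : α) :
    inclusionSum h Z m A (insert b B) =
      inclusionSum h Z m A B - inclusionSum h Z m (insert b A) B := by
  simp only [inclusionSum, Finset.sum_filter]
  rw [← Finset.sum_sub_distrib]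
  refine Finset.sum_congr rfl fun C _ => ?_
  by_cases h1 : b ∈ C <;> by_cases h2 : A ⊆ C <;> by_cases h3 : Disjoint B C <;>
    simp [h1, h2, h3, Finset.insert_subset_iff]

variable {p : ℕ} [CharP F p]

theorem inclusionSum_eq_zero
    (hker : ∀ Y ⊆ Z, Y.card + 1 = m → ∑ a ∈ Z \ Y, h (insert a Y) = 0) {A B : Finset α}
    (hA : A ⊆ Z) (hB : B ⊆ Z) (hAB : Disjoint A B) (hm : A.card + B.card < m)
    (hp : m < A.card + p) : inclusionSum h Z m A B = 0 := by
  induction B using Finset.induction_on generalizing A with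
  | empty =>
    obtain ⟨j, hj⟩ : ∃ j, A.card + (j + 1) = m := ⟨m - A.card - 1, by simp at hm; omega⟩
    induction j generalizing A with
    | zero =>
      have h1 := sum_inclusionSum_insert (h := h) (Z := Z) hj
      rw [← hker A hA hj] at *
      rw [Nat.zero_add, Nat.cast_one, one_mul] at h1
      rw [← h1]
      refine Finset.sum_congr rfl fun a ha => ?_
      obtain ⟨h2, h3⟩ := Finset.mem_sdiff.1 ha
      exact inclusionSum_of_card_eq (Finset.insert_subset h2 hA)
        (by rw [Finset.card_insert_of_notMem h3, hj])
    | succ j ih =>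
      have h1 := sum_inclusionSum_insert (h := h) (Z := Z) hj
      rw [Finset.sum_eq_zero] at h1
      · rcases mul_eq_zero.1 h1.symm with h2 | h2
        · rw [CharP.cast_eq_zero_iff F p] at h2
          have := Nat.le_of_dvd (by omega) h2
          omega
        · exact h2
      · intro a ha
        obtain ⟨h2, h3⟩ := Finset.mem_sdiff.1 ha
        have h4 := Finset.card_insert_of_notMem h3
        exact ih (Finset.insert_subset h2 hA) (by simp) (by simp; omega) (by omega) (by omega)
  | insert b B hb ih =>
    rw [Finset.card_insert_of_notMem hb] at hm
    rw [Finset.insert_subset_iff] at hB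
    rw [Finset.disjoint_insert_right] at hAB
    have h4 := Finset.card_insert_of_notMem hAB.1
    rw [inclusionSum_insert_right, ih hA hB.2 hAB.2 (by omega) hp,
      ih (Finset.insert_subset hB.1 hA) hB.2 (by simp [hb, hAB.2]) (by omega) (by omega), sub_zero]

/-- The alternating sum over transversals of `M`-indexed pairs `{x i, y i}` vanishes. -/
theorem sum_transversal_eq_zero {ι : Type*} [DecidableEq ι]
    (hker : ∀ Y ⊆ Z, Y.card + 1 = m → ∑ a ∈ Z \ Y, h (insert a Y) = 0)
    (M : Finset ι) (x y : ι → α) (hx : Set.InjOn x M) (hy : Set.InjOn y M)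
    (hxy : ∀ i ∈ M, ∀ j ∈ M, x i ≠ y j) (L Q : Finset α)
    (hxL : ∀ i ∈ M, x i ∉ L) (hyL : ∀ i ∈ M, y i ∉ L)
    (hxQ : ∀ i ∈ M, x i ∉ Q) (hyQ : ∀ i ∈ M, y i ∉ Q) (hLQ : ∀ a ∈ L, a ∉ Q)
    (hZ : Z = L ∪ Q ∪ M.image x ∪ M.image y) (hL : L.card + 1 = p) (hQ : Q.card + 2 = p)
    (hm : m = L.card + M.card) :
    ∑ τ ∈ M.powerset, (-1) ^ τ.card * h (L ∪ ((M \ τ).image x ∪ τ.image y)) = 0 := by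
  have hcard : ∀ τ ⊆ M, ((M \ τ).image x ∪ τ.image y).card = M.card := by
    intro τ hτ
    rw [Finset.card_union_of_disjoint, Finset.card_image_of_injOn (hx.mono (by simp)),
      Finset.card_image_of_injOn (hy.mono (by simpa using hτ)),
      Finset.card_sdiff_add_card_eq_card hτ]
    rw [Finset.disjoint_left]
    intro a ha hb
    obtain ⟨i, hi, rfl⟩ := Finset.mem_image.1 ha
    obtain ⟨j, hj, hij⟩ := Finset.mem_image.1 hb
    exact hxy i (Finset.mem_sdiff.1 hi).1 j (hτ hj) hij.symm
  have hsub : ∀ τ ⊆ M, (M \ τ).image x ∪ τ.image y ⊆ Z := by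
    intro τ hτ a ha
    rw [hZ]
    simp only [Finset.mem_union, Finset.mem_image, Finset.mem_sdiff] at ha ⊢
    rcases ha with ⟨i, hi, rfl⟩ | ⟨i, hi, rfl⟩
    · exact Or.inl (Or.inr ⟨i, hi.1, rfl⟩)
    · exact Or.inr ⟨i, hτ hi, rfl⟩
  have hzero : ∀ τ ⊆ M, inclusionSum h Z m ((M \ τ).image x ∪ τ.image y) Q = 0 := by
    intro τ hτ
    have hc := hcard τ hτ
    refine inclusionSum_eq_zero (p := p) hker (hsub τ hτ) ?_ ?_ (by omega) (by omega)
    · rw [hZ]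
      intro a ha
      simp [ha]
    · rw [Finset.disjoint_left]
      intro a ha hb
      simp only [Finset.mem_union, Finset.mem_image, Finset.mem_sdiff] at ha
      rcases ha with ⟨i, hi, rfl⟩ | ⟨i, hi, rfl⟩
      · exact hxQ i hi.1 hb
      · exact hyQ i (hτ hi) hb
  have hmain : ∀ τ ⊆ M, h (L ∪ ((M \ τ).image x ∪ τ.image y)) =
      inclusionSum h Z m ((M \ τ).image x ∪ τ.image y)
        (Q ∪ (τ.image x ∪ (M \ τ).image y)) := by
    intro τ hτ
    have hLc : (L ∪ ((M \ τ).image x ∪ τ.image y)).card = m := by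
      rw [Finset.card_union_of_disjoint, hcard τ hτ, hm]
      rw [Finset.disjoint_left]
      intro a hb ha
      simp only [Finset.mem_union, Finset.mem_image, Finset.mem_sdiff] at ha
      rcases ha with ⟨i, hi, rfl⟩ | ⟨i, hi, rfl⟩
      · exact hxL i hi.1 hb
      · exact hyL i (hτ hi) hb
    have hQd : Disjoint (Q ∪ (τ.image x ∪ (M \ τ).image y))
        (L ∪ ((M \ τ).image x ∪ τ.image y)) := by
      rw [Finset.disjoint_left]
      intro a ha hb
      simp only [Finset.mem_union, Finset.mem_image, Finset.mem_sdiff] at ha hb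
      rcases ha with ha | ⟨i, hi, rfl⟩ | ⟨i, hi, rfl⟩ <;>
        rcases hb with hb | ⟨j, hj, hij⟩ | ⟨j, hj, hij⟩
      · exact hLQ a hb ha
      · exact hxQ j hj.1 (hij ▸ ha)
      · exact hyQ j (hτ hj) (hij ▸ ha)
      · exact hxL i (hτ hi) hb
      · rw [hx hj.1 (hτ hi) hij] at hj
        exact hj.2 hi
      · exact hxy i (hτ hi) j (hτ hj) hij.symm
      · exact hyL i hi.1 hb
      · exact hxy j hj.1 i hi.1 hij
      · rw [hy (hτ hj) hi.1 hij] at hj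
        exact hi.2 hj
    have hfil : (Z.powersetCard m).filter (fun C => (M \ τ).image x ∪ τ.image y ⊆ C ∧
        Disjoint (Q ∪ (τ.image x ∪ (M \ τ).image y)) C) =
        {L ∪ ((M \ τ).image x ∪ τ.image y)} := by
      ext C
      simp only [Finset.mem_filter, Finset.mem_powersetCard, Finset.mem_singleton]
      constructor
      · rintro ⟨⟨h1, h2⟩, -, h3⟩
        refine Finset.eq_of_subset_of_card_le (fun a ha => ?_) (by omega)
        have h4 := h1 ha
        have h5 := Finset.disjoint_right.1 h3 ha
        rw [hZ] at h4
        simp only [Finset.mem_union, Finset.mem_image, Finset.mem_sdiff, not_or] at h4 h5 ⊢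
        rcases h4 with ((h4 | h4) | ⟨i, hi, rfl⟩) | ⟨i, hi, rfl⟩
        · exact Or.inl h4
        · exact absurd h4 h5.1
        · exact Or.inr (Or.inl ⟨i, ⟨hi, fun h6 => h5.2.1 ⟨i, h6, rfl⟩⟩, rfl⟩)
        · exact Or.inr (Or.inr ⟨i, by_contra fun h6 => h5.2.2 ⟨i, ⟨hi, h6⟩, rfl⟩, rfl⟩)
      · rintro rfl
        refine ⟨⟨Finset.union_subset ?_ (hsub τ hτ), hLc⟩, Finset.subset_union_right, hQd⟩
        rw [hZ]
        intro a ha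
        simp [ha]
    rw [inclusionSum, hfil, Finset.sum_singleton]
  have hexp : ∀ C : Finset α, ∑ τ ∈ M.powerset, (-1 : F) ^ τ.card *
      (if (M \ τ).image x ∪ τ.image y ⊆ C then 1 else 0) =
      ∑ τ ∈ M.powerset, (-1 : F) ^ τ.card * (if (M \ τ).image x ∪ τ.image y ⊆ C ∧
        Disjoint (τ.image x ∪ (M \ τ).image y) C then 1 else 0) := by
    intro C
    have e1 : ∏ i ∈ M, ((if x i ∈ C then 1 else 0) - (if y i ∈ C then 1 else 0) : F) =
        ∏ i ∈ M, ((if x i ∈ C ∧ y i ∉ C then 1 else 0) -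
          (if y i ∈ C ∧ x i ∉ C then 1 else 0) : F) := by
      refine Finset.prod_congr rfl fun i _ => ?_
      by_cases h1 : x i ∈ C <;> by_cases h2 : y i ∈ C <;> simp [h1, h2]
    rw [Finset.prod_sub, Finset.prod_sub] at e1
    simp only [Finset.prod_boole, mul_ite, mul_zero, mul_one, ← ite_and] at e1
    simp only [mul_ite, mul_zero, mul_one]
    refine (Finset.sum_congr rfl fun τ _ => ?_).trans
      (e1.trans (Finset.sum_congr rfl fun τ _ => ?_))
    · refine if_congr ?_ rfl rfl
      rw [Finset.union_subset_iff, Finset.image_subset_iff, Finset.image_subset_iff, and_comm]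
    · refine if_congr (Iff.symm ?_) rfl rfl
      rw [Finset.union_subset_iff, Finset.image_subset_iff, Finset.image_subset_iff,
        Finset.disjoint_union_left, Finset.disjoint_left, Finset.disjoint_left]
      simp only [Finset.forall_mem_image]
      constructor
      · rintro ⟨⟨h1, h2⟩, h3, h4⟩
        exact ⟨fun i hi => ⟨h2 i hi, h3 hi⟩, fun i hi => ⟨h1 i hi, h4 hi⟩⟩
      · rintro ⟨h1, h2⟩
        exact ⟨⟨fun i hi => (h2 i hi).1, fun i hi => (h1 i hi).1⟩, fun i hi => (h1 i hi).2,
          fun i hi => (h2 i hi).2⟩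
  calc ∑ τ ∈ M.powerset, (-1) ^ τ.card * h (L ∪ ((M \ τ).image x ∪ τ.image y))
      = ∑ C ∈ Z.powersetCard m, (if Disjoint Q C then h C else 0) *
        ∑ τ ∈ M.powerset, (-1 : F) ^ τ.card * (if (M \ τ).image x ∪ τ.image y ⊆ C ∧
        Disjoint (τ.image x ∪ (M \ τ).image y) C then 1 else 0) := by
        simp only [Finset.mul_sum]
        rw [Finset.sum_comm]
        refine Finset.sum_congr rfl fun τ hτ => ?_
        rw [hmain τ (Finset.mem_powerset.1 hτ), inclusionSum, Finset.sum_filter, Finset.mul_sum]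
        refine Finset.sum_congr rfl fun C _ => ?_
        by_cases h1 : Disjoint Q C <;> by_cases h2 : (M \ τ).image x ∪ τ.image y ⊆ C <;>
          by_cases h3 : Disjoint (τ.image x ∪ (M \ τ).image y) C <;>
          simp only [Finset.disjoint_union_left (s := Q), h1, h2, h3, and_true, and_false,
            if_true, if_false, mul_zero, zero_mul, one_mul, mul_comm]
    _ = ∑ C ∈ Z.powersetCard m, (if Disjoint Q C then h C else 0) *
        ∑ τ ∈ M.powerset, (-1 : F) ^ τ.card *
          (if (M \ τ).image x ∪ τ.image y ⊆ C then 1 else 0) := by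
        simp only [hexp]
    _ = ∑ τ ∈ M.powerset, (-1) ^ τ.card *
        inclusionSum h Z m ((M \ τ).image x ∪ τ.image y) Q := by
        simp only [Finset.mul_sum]
        rw [Finset.sum_comm]
        refine Finset.sum_congr rfl fun τ _ => ?_
        rw [inclusionSum, Finset.sum_filter, Finset.mul_sum]
        refine Finset.sum_congr rfl fun C _ => ?_
        by_cases h1 : Disjoint Q C <;> by_cases h2 : (M \ τ).image x ∪ τ.image y ⊆ C <;>
          simp only [h1, h2, and_true, and_false, if_true, if_false, mul_zero, zero_mul, one_mul,
            mul_comm]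
    _ = 0 := Finset.sum_eq_zero fun τ hτ => by
        rw [hzero τ (Finset.mem_powerset.1 hτ), mul_zero]

end Inclusion

section Subsequences

variable {α : Type} (d : α) (l : List α) (s : Finset ℕ)

theorem map_getD_range : (List.range l.length).map (fun i => l.getD i d) = l := by
  refine List.ext_getElem (by simp) fun i h1 h2 => ?_
  simp [h2]

theorem subseq_sublist : (subseq d l s).Sublist l := by
  conv_rhs => rw [← map_getD_range d l]
  exact List.filter_sublist.map _

theorem subseqC_sublist : (subseqC d l s).Sublist l := by
  conv_rhs => rw [← map_getD_range d l]
  exact List.filter_sublist.map _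

theorem subseqC_append_subseq_perm : (subseqC d l s ++ subseq d l s).Perm l := by
  conv_rhs => rw [← map_getD_range d l]
  rw [subseq, subseqC, ← List.map_append]
  refine List.Perm.map _ (List.perm_append_comm.trans ?_)
  simpa using List.filter_append_perm (fun i => decide (i ∈ s)) (List.range l.length)

variable {d l s}

theorem mem_subseq {v : α} : v ∈ subseq d l s ↔ ∃ i < l.length, i ∈ s ∧ l.getD i d = v := by
  simp [subseq, and_assoc]

theorem mem_subseqC {v : α} : v ∈ subseqC d l s ↔ ∃ i < l.length, i ∉ s ∧ l.getD i d = v := by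
  simp [subseqC, and_assoc]

theorem length_subseq_congr {l' : List α} (h : l.length = l'.length) :
    (subseq d l s).length = (subseq d l' s).length := by
  simp [subseq, h]

theorem subseq_concat (x : α) :
    subseq d (l ++ [x]) s = subseq d l s ++ if l.length ∈ s then [x] else [] := by
  have h : ∀ i ∈ (List.range l.length).filter (fun i => decide (i ∈ s)),
      (l ++ [x]).getD i d = l.getD i d := by
    intro i hi
    have : i < l.length := by simpa using (List.mem_filter.1 hi).1
    simp [List.getElem?_append_left this]
  rw [subseq, List.length_append, List.length_singleton, List.range_succ, List.filter_append,
    List.map_append, List.map_congr_left h, subseq]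
  split_ifs with hs <;> simp [hs]

theorem subseqC_concat (x : α) :
    subseqC d (l ++ [x]) s = subseqC d l s ++ if l.length ∈ s then [] else [x] := by
  have h : ∀ i ∈ (List.range l.length).filter (fun i => decide (i ∉ s)),
      (l ++ [x]).getD i d = l.getD i d := by
    intro i hi
    have : i < l.length := by simpa using (List.mem_filter.1 hi).1
    simp [List.getElem?_append_left this]
  rw [subseqC, List.length_append, List.length_singleton, List.range_succ, List.filter_append,
    List.map_append, List.map_congr_left h, subseqC]
  split_ifs with hs <;> simp [hs]

theorem length_subseq : (subseq d l s).length = ((Finset.range l.length).filter (· ∈ s)).card := by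
  simp only [subseq, List.length_map]
  rfl

theorem invCount_succ (s : Finset ℕ) (n : ℕ) :
    invCount s (n + 1) =
      invCount s n + if n ∈ s then 0 else ((Finset.range n).filter (· ∈ s)).card := by
  have h : ((Finset.range (n + 1) ×ˢ Finset.range (n + 1)).filter
      (fun ij => ij.1 ∈ s ∧ ij.2 ∉ s ∧ ij.1 < ij.2)) =
      ((Finset.range n ×ˢ Finset.range n).filter
        (fun ij => ij.1 ∈ s ∧ ij.2 ∉ s ∧ ij.1 < ij.2)) ∪
      (if n ∈ s then ∅ else ((Finset.range n).filter (· ∈ s)) ×ˢ {n}) := by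
    ext ⟨i, j⟩
    split_ifs with hs <;> simp <;> grind
  rw [invCount, h, Finset.card_union_of_disjoint, invCount]
  · split_ifs <;> simp
  · rw [Finset.disjoint_left]
    rintro ⟨i, j⟩ h1 h2
    split_ifs at h2 <;> simp at h1 h2
    omega

end Subsequences

section Determinants

variable {F : Type} [Field F] {k : ℕ}

theorem detCols_subseqC_append_subseq (pre X R : List (Fin k → F)) (s : Finset ℕ)
    (h : pre.length + X.length ≤ k) :
    detCols (pre ++ (subseqC 0 X s ++ (subseq 0 X s ++ R))) =
      (-1) ^ invCount s X.length * detCols (pre ++ (X ++ R)) := by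
  induction X using List.reverseRecOn generalizing R with
  | nil => simp [subseq, subseqC, invCount]
  | append_singleton X x ih =>
    have hlen : pre.length + X.length + 1 ≤ k := by simpa [add_assoc] using h
    have hp := (subseqC_append_subseq_perm 0 X s).length_eq
    rw [List.length_append] at hp
    have ih' := ih (x :: R) (by omega)
    rw [subseq_concat, subseqC_concat, List.length_append, List.length_singleton, invCount_succ]
    split_ifs with hs
    · simpa using ih'
    · have hm := detCols_move (pre ++ subseqC 0 X s) x (subseq 0 X s) R
        (by rw [List.length_append]; omega)
      rw [← length_subseq (d := (0 : Fin k → F))]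
      simp only [List.append_assoc, List.cons_append, List.nil_append, List.append_nil] at hm ih' ⊢
      rw [hm, ih', pow_add]
      ring

end Determinants

section Scalings

variable {F : Type} [Field F] [DecidableEq F] {k t : ℕ} {S : Finset (Fin k → F)}
  {T : Finset (Fin k → F) → (Fin k → F) → F} {G : List (Fin k → F) → F}

theorem IsTangentFamily.exists_ne_zero (hT : IsTangentFamily t S T) (hG : IsScaling t S T G)
    {l : List (Fin k → F)} (hl : l.length + 2 = k) (hnd : l.Nodup) (hlS : ∀ v ∈ l, v ∈ S)
    (hne : ∃ a ∈ S, a ∉ l) :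
    ∃ c ≠ 0, ∀ a ∈ S, a ∉ l → T l.toFinset a = c * G (a :: l) ∧ G (a :: l) ≠ 0 := by
  obtain ⟨c, hc⟩ := hG.tangent l hl hnd hlS
  have hT0 : ∀ a ∈ S, a ∉ l → T l.toFinset a ≠ 0 := fun a ha hal =>
    hT.ne_zero (fun v hv => hlS v (by simpa using hv))
      (by rw [List.toFinset_card_of_nodup hnd]; omega) ha (by simpa using hal)
  obtain ⟨a, ha, hal⟩ := hne
  have hc0 : c ≠ 0 := by
    rintro rfl
    exact hT0 a ha hal (by rw [hc a ha hal, zero_mul])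
  refine ⟨c, hc0, fun b hb hbl => ⟨hc b hb hbl, fun h => hT0 b hb hbl ?_⟩⟩
  rw [hc b hb hbl, h, mul_zero]

theorem IsScaling.move (hG : IsScaling t S T G) (pre post : List (Fin k → F)) (a : Fin k → F)
    (hl : pre.length + post.length + 2 = k) :
    G (a :: (pre ++ post)) = ((-1) ^ pre.length) ^ (t + 1) * G (pre ++ a :: post) := by
  refine hG.perm _ _ _ List.perm_middle fun z => ?_
  simpa using detCols_move [z] a pre post (by simp; omega)

theorem IsTangentFamily.scaling_ne_zero (hT : IsTangentFamily t S T) (hG : IsScaling t S T G)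
    {l : List (Fin k → F)} (hl : l.length + 1 = k) (hk : 2 ≤ k) (hnd : l.Nodup)
    (hlS : ∀ v ∈ l, v ∈ S) : G l ≠ 0 := by
  cases l with
  | nil => simp at hl; omega
  | cons a l =>
    rw [List.nodup_cons] at hnd
    have ha := hlS a List.mem_cons_self
    obtain ⟨c, -, h⟩ := hT.exists_ne_zero hG (by simpa using hl) hnd.2
      (fun v hv => hlS v (List.mem_cons_of_mem _ hv)) ⟨a, ha, hnd.1⟩
    exact (h a ha hnd.1).2

theorem IsTangentFamily.ratio_eq (hT : IsTangentFamily t S T) (hG : IsScaling t S T G)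
    {pre post : List (Fin k → F)} {a b : Fin k → F} (hl : pre.length + post.length + 2 = k)
    (hnd : (a :: b :: (pre ++ post)).Nodup) (hS : ∀ v ∈ a :: b :: (pre ++ post), v ∈ S) :
    T (pre ++ post).toFinset a * (T (pre ++ post).toFinset b)⁻¹ =
      G (pre ++ a :: post) / G (pre ++ b :: post) := by
  simp only [List.nodup_cons, List.mem_cons, not_or] at hnd
  simp only [List.forall_mem_cons] at hS
  obtain ⟨c, hc, h⟩ := hT.exists_ne_zero hG (l := pre ++ post) (by simpa using hl) hnd.2.2 hS.2.2
    ⟨a, hS.1, hnd.1.2⟩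
  rw [(h a hS.1 hnd.1.2).1, (h b hS.2.1 hnd.2.1).1, hG.move _ _ _ hl, hG.move _ _ _ hl,
    ← div_eq_mul_inv, mul_div_mul_left _ _ hc, mul_div_mul_left]
  exact pow_ne_zero _ (pow_ne_zero _ (by simp))

theorem segreP_cons (D : Finset (Fin k → F)) (a b : Fin k → F) (A B : List (Fin k → F)) :
    segreP T D (a :: A) (b :: B) =
      T (D ∪ B.toFinset) a * (T (D ∪ B.toFinset) b)⁻¹ * segreP T (insert a D) A B := by
  rw [segreP, List.length_cons, Finset.prod_range_succ', mul_comm, segreP]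
  congr 1
  · simp
  · refine Finset.prod_congr rfl fun j _ => ?_
    simp [Finset.union_insert, Finset.insert_union]

theorem IsTangentFamily.segreP_eq (hT : IsTangentFamily t S T) (hG : IsScaling t S T G)
    {P A B R : List (Fin k → F)} (hAB : A.length = B.length)
    (hl : P.length + A.length + R.length + 1 = k) (hk : 2 ≤ k)
    (hnd : (A ++ B ++ P ++ R).Nodup) (hS : ∀ v ∈ A ++ B ++ P ++ R, v ∈ S)
    {D : Finset (Fin k → F)} (hD : D = R.toFinset ∪ P.toFinset) :
    segreP T D A B = G (P ++ A ++ R) / G (P ++ B ++ R) := by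
  induction A generalizing P B D with
  | nil =>
    obtain rfl : B = [] := List.length_eq_zero_iff.1 hAB.symm
    rw [div_self]
    · simp [segreP]
    · refine hT.scaling_ne_zero hG ?_ hk (by simpa using hnd) (by simpa using hS)
      simp at hl ⊢
      omega
  | cons a A ih =>
    cases B with
    | nil => simp at hAB
    | cons b B =>
      have hset : D ∪ B.toFinset = (P ++ (B ++ R)).toFinset := by
        rw [hD]
        ext
        simp
        tauto
      have hlen : A.length = B.length := by simpa using hAB
      simp only [List.length_cons] at hl
      rw [List.nodup_iff_count_le_one] at hnd
      simp only [List.count_append, List.count_cons] at hnd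
      have hmem : ∀ l : List (Fin k → F), l ⊆ a :: A ++ b :: B ++ P ++ R → ∀ v ∈ l, v ∈ S :=
        fun l hl v hv => hS v (hl hv)
      rw [segreP_cons, hset, hT.ratio_eq hG, ih (P := P ++ [a]) hlen]
      · have : G (P ++ a :: (B ++ R)) ≠ 0 := by
          refine hT.scaling_ne_zero hG (by simp; omega) hk ?_ (hmem _ ?_)
          · rw [List.nodup_iff_count_le_one]
            intro v
            have := hnd v
            simp only [List.count_append, List.count_cons]
            omega
          · intro v
            simp
            tauto
        simp only [List.append_assoc, List.cons_append, List.nil_append]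
        rw [mul_comm, div_mul_div_cancel₀ this]
      · simp; omega
      · rw [List.nodup_iff_count_le_one]
        intro v
        have := hnd v
        simp only [List.count_append, List.count_cons, List.count_nil]
        omega
      · refine hmem _ fun v => ?_
        simp
        tauto
      · rw [hD]
        ext
        simp
      · simp; omega
      · rw [List.nodup_iff_count_le_one]
        intro v
        have := hnd v
        simp only [List.count_append, List.count_cons]
        omega
      · refine hmem _ fun v => ?_
        simp
        tauto

theorem IsScaling.subseqC_append_subseq (hG : IsScaling t S T G) (X R : List (Fin k → F))
    (s : Finset ℕ) (h : X.length + 1 ≤ k) :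
    G (subseqC 0 X s ++ subseq 0 X s ++ R) =
      (-1) ^ ((t + 1) * invCount s X.length) * G (X ++ R) := by
  rw [mul_comm (t + 1), pow_mul]
  refine hG.perm _ _ _ ((subseqC_append_subseq_perm 0 X s).symm.append_right R) fun z => ?_
  simpa using detCols_subseqC_append_subseq [z] X R s (by simp; omega)

/-- The function on `(k - 1)`-subsets obtained from `G` by dividing by determinants. -/
noncomputable def weight (G : List (Fin k → F) → F) (Z C : Finset (Fin k → F)) : F :=
  G C.toList * ∏ z ∈ Z \ C, (detCols (z :: C.toList))⁻¹

theorem IsScaling.weight_toFinset (hG : IsScaling t S T G) {Z : Finset (Fin k → F)}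
    {l : List (Fin k → F)} (hnd : l.Nodup) (hl : l.length + 1 = k)
    (hZ : (Z \ l.toFinset).card = t + 1) :
    weight G Z l.toFinset = G l * ∏ z ∈ Z \ l.toFinset, (detCols (z :: l))⁻¹ := by
  have hperm : l.Perm l.toFinset.toList := (List.toFinset_toList hnd).symm
  obtain ⟨s, hs, hdet⟩ := exists_sign_of_perm hperm
  have hdet' : ∀ z, detCols (z :: l.toFinset.toList) = s * detCols (z :: l) := fun z => by
    simpa using hdet [z] (by simp; omega)
  have hpow : s ^ (t + 1) * s⁻¹ ^ (t + 1) = 1 := by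
    rw [← mul_pow, mul_inv_cancel₀ (left_ne_zero_of_mul_eq_one hs), one_pow]
  rw [weight, hG.perm _ _ _ hperm hdet']
  simp only [hdet', mul_inv, Finset.prod_mul_distrib, Finset.prod_const, hZ]
  linear_combination (G l * ∏ z ∈ Z \ l.toFinset, (detCols (z :: l))⁻¹) * hpow

theorem IsTangentFamily.sum_weight_eq_zero (hT : IsTangentFamily t S T) (hG : IsScaling t S T G)
    (hS : IsVectorArc S) (hk : 2 ≤ k) {Y Z : Finset (Fin k → F)} (hZS : Z ⊆ S) (hYZ : Y ⊆ Z)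
    (hY : Y.card + 2 = k) (hZ : Z.card = k + t) : ∑ a ∈ Z \ Y, weight G Z (insert a Y) = 0 := by
  have hlS : ∀ v ∈ Y.toList, v ∈ S := fun v hv => hZS (hYZ (by simpa using hv))
  have hcard : (Z \ Y).card = t + 2 := by
    rw [Finset.card_sdiff_of_subset hYZ]
    omega
  obtain ⟨a₀, ha₀⟩ : (Z \ Y).Nonempty := Finset.card_pos.1 (by omega)
  rw [Finset.mem_sdiff] at ha₀
  obtain ⟨c, hc, h⟩ := hT.exists_ne_zero hG (by simpa using hY) Y.nodup_toList hlS
    ⟨a₀, hZS ha₀.1, by simpa using ha₀.2⟩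
  obtain ⟨Φ, hΦ, -, hΦY, -, hprod⟩ := hT Y (hYZ.trans hZS) (by omega)
  have hsum := hS.sum_prod_forms_eq_zero (by simpa using hY) Y.nodup_toList hlS Φ
    (fun α hα v hv => hΦY α hα v (by simpa using hv)) (Z \ Y) (Finset.sdiff_subset.trans hZS)
    (by simp) (by rw [hcard, hΦ])
  rw [← mul_eq_zero_iff_left hc, Finset.mul_sum, ← hsum]
  refine Finset.sum_congr rfl fun a ha => ?_
  rw [Finset.mem_sdiff] at ha
  have haY : a ∉ Y.toList := by simpa using ha.2
  have hins : insert a Y = (a :: Y.toList).toFinset := by simp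
  have hdiff : Z \ insert a Y = (Z \ Y).erase a := by
    ext
    simp
    tauto
  rw [hins, hG.weight_toFinset (List.nodup_cons.2 ⟨haY, Y.nodup_toList⟩) (by simp; omega),
    ← hins, hdiff, ← mul_assoc, ← (h a (hZS ha.1) haY).1, Finset.toList_toFinset, hprod]
  rw [← hins, hdiff, Finset.card_erase_of_mem (Finset.mem_sdiff.2 ha), hcard]
  rfl

end Scalings

section Descent

/-- Linear relations among the functions `D τ` allow to trade a reciprocal factor for a numerator
factor in a vanishing sum of products. -/
theorem sum_prod_mul_prod_inv_eq_zero {ι V F : Type*} [DecidableEq V] [Field F] (I : Finset ι)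
    (κ : ι → F) (D : ι → V → F) (U : Finset V) (n : ℕ) (hD : ∀ τ ∈ I, ∀ b ∈ U, D τ b ≠ 0)
    (hspan : ∀ Q ⊆ U, Q.card = n + 1 → ∀ v, ∃ c : V → F, ∀ τ ∈ I,
      D τ v = ∑ b ∈ Q, c b * D τ b)
    (hbase : ∀ Q ⊆ U, Q.card = n → ∑ τ ∈ I, κ τ * ∏ z ∈ Q, (D τ z)⁻¹ = 0)
    (r : ℕ) (v : ℕ → V) (Q : Finset V) (hQ : Q ⊆ U) (hcard : Q.card = n + r) :
    ∑ τ ∈ I, κ τ * (∏ i ∈ Finset.range r, D τ (v i)) * ∏ z ∈ Q, (D τ z)⁻¹ = 0 := by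
  induction r generalizing Q with
  | zero => simpa using hbase Q hQ hcard
  | succ r ih =>
    obtain ⟨Q₀, hQ₀, hQ₀c⟩ := Finset.exists_subset_card_eq (show n + 1 ≤ Q.card by omega)
    obtain ⟨c, hc⟩ := hspan Q₀ (hQ₀.trans hQ) hQ₀c (v r)
    calc _ = ∑ τ ∈ I, ∑ b ∈ Q₀, c b * (κ τ * (∏ i ∈ Finset.range r, D τ (v i)) *
          ∏ z ∈ Q.erase b, (D τ z)⁻¹) := by
          refine Finset.sum_congr rfl fun τ hτ => ?_
          rw [Finset.prod_range_succ, hc τ hτ, Finset.mul_sum, Finset.mul_sum, Finset.sum_mul]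
          refine Finset.sum_congr rfl fun b hb => ?_
          rw [← Finset.mul_prod_erase Q _ (hQ₀ hb)]
          have := hD τ hτ b (hQ (hQ₀ hb))
          field_simp
      _ = 0 := by
          rw [Finset.sum_comm]
          refine Finset.sum_eq_zero fun b hb => ?_
          rw [← Finset.mul_sum, ih (Q.erase b) ((Finset.erase_subset _ _).trans hQ), mul_zero]
          rw [Finset.card_erase_of_mem (hQ₀ hb), hcard]
          rfl

end Descent

section Transversals

variable {F : Type} [Field F] [DecidableEq F] {k t p n : ℕ} {S : Finset (Fin k → F)}
  {T : Finset (Fin k → F) → (Fin k → F) → F} {G : List (Fin k → F) → F}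

theorem toFinset_subseq {X : List (Fin k → F)} {τ : Finset ℕ} (hτ : τ ⊆ Finset.range X.length) :
    (subseq 0 X τ).toFinset = τ.image (fun i => X.getD i 0) := by
  ext v
  rw [List.mem_toFinset, mem_subseq, Finset.mem_image]
  exact ⟨fun ⟨i, _, h, e⟩ => ⟨i, h, e⟩, fun ⟨i, h, e⟩ => ⟨i, Finset.mem_range.1 (hτ h), h, e⟩⟩

theorem toFinset_subseqC {X : List (Fin k → F)} {τ : Finset ℕ} :
    (subseqC 0 X τ).toFinset = (Finset.range X.length \ τ).image (fun i => X.getD i 0) := by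
  ext v
  simp [mem_subseqC, and_assoc]

theorem toFinset_eq_image_range (X : List (Fin k → F)) :
    X.toFinset = (Finset.range X.length).image (fun i => X.getD i 0) := by
  conv_lhs => rw [← map_getD_range 0 X]
  ext v
  simp

theorem sdiff_transversal {α : Type*} [DecidableEq α] {A B C D L : List α} {Q : Finset α}
    (hnd : (A ++ B ++ (C ++ D) ++ L).Nodup) (hd : ∀ v ∈ A ++ B ++ (C ++ D) ++ L, v ∉ Q) :
    (L.toFinset ∪ Q ∪ (A ++ B).toFinset ∪ (C ++ D).toFinset) \ (A ++ D ++ L).toFinset =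
      B.toFinset ∪ C.toFinset ∪ Q := by
  simp only [List.nodup_append', List.disjoint_append_left, List.disjoint_append_right] at hnd
  obtain ⟨⟨⟨-, -, hAB⟩, ⟨-, -, hCD⟩, ⟨hAC, hBC⟩, hAD, hBD⟩, -, ⟨hAL, hBL⟩, hCL, hDL⟩ := hnd
  ext v
  have hv := hd v
  simp only [List.mem_append, Finset.mem_sdiff, Finset.mem_union, List.mem_toFinset] at hv ⊢
  have h1 := @hAB v
  have h2 := @hCD v
  have h3 := @hBD v
  have h4 := @hAC v
  have h5 := @hBL v
  have h6 := @hCL v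
  grind

theorem IsTangentFamily.sum_transversal_eq_zero [CharP F p] (hT : IsTangentFamily t S T)
    (hG : IsScaling t S T G) (hS : IsVectorArc S) (ht : t + 3 = k) (hnp : n + p = k)
    {X Y L : List (Fin k → F)} {Q : Finset (Fin k → F)} (hX : X.length = n) (hY : Y.length = n)
    (hL : L.length + 1 = p) (hQ : Q.card + 2 = p) (hnd : (X ++ Y ++ L).Nodup)
    (hXS : ∀ v ∈ X ++ Y ++ L, v ∈ S) (hQS : Q ⊆ S) (hd : ∀ v ∈ X ++ Y ++ L, v ∉ Q) :
    ∑ τ ∈ (Finset.range n).powerset, (-1) ^ τ.card *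
      (G (subseqC 0 X τ ++ subseq 0 Y τ ++ L) *
        ∏ z ∈ (subseq 0 X τ).toFinset ∪ (subseqC 0 Y τ).toFinset ∪ Q,
          (detCols (z :: (subseqC 0 X τ ++ subseq 0 Y τ ++ L)))⁻¹) = 0 := by
  set x : ℕ → Fin k → F := fun i => X.getD i 0 with hx
  set y : ℕ → Fin k → F := fun i => Y.getD i 0 with hy
  obtain ⟨Z, hZ⟩ : ∃ Z, Z = L.toFinset ∪ Q ∪ (Finset.range n).image x ∪
    (Finset.range n).image y := ⟨_, rfl⟩
  have hXx : (Finset.range n).image x = X.toFinset := by rw [toFinset_eq_image_range, hX]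
  have hYy : (Finset.range n).image y = Y.toFinset := by rw [toFinset_eq_image_range, hY]
  have hmemX : ∀ i ∈ Finset.range n, x i ∈ X := fun i hi => by
    rw [← List.mem_toFinset, ← hXx]
    exact Finset.mem_image_of_mem x hi
  have hmemY : ∀ i ∈ Finset.range n, y i ∈ Y := fun i hi => by
    rw [← List.mem_toFinset, ← hYy]
    exact Finset.mem_image_of_mem y hi
  have hnd' := hnd
  simp only [List.nodup_append, List.mem_append] at hnd'
  obtain ⟨⟨hXnd, hYnd, hXY⟩, hLnd, hXYL⟩ := hnd'
  simp only [List.mem_append] at hd hXS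
  have hcX := List.toFinset_card_of_nodup hXnd
  have hcY := List.toFinset_card_of_nodup hYnd
  have hcL := List.toFinset_card_of_nodup hLnd
  have hxinj : Set.InjOn x (Finset.range n) := by
    rw [← Finset.card_image_iff, hXx, hcX, hX, Finset.card_range]
  have hyinj : Set.InjOn y (Finset.range n) := by
    rw [← Finset.card_image_iff, hYy, hcY, hY, Finset.card_range]
  have hZS : Z ⊆ S := by
    intro v hv
    rw [hZ, hXx, hYy] at hv
    simp only [Finset.mem_union, List.mem_toFinset] at hv
    rcases hv with ((h | h) | h) | h
    · exact hXS v (Or.inr h)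
    · exact hQS h
    · exact hXS v (Or.inl (Or.inl h))
    · exact hXS v (Or.inl (Or.inr h))
  have hZc : Z.card = k + t := by
    rw [hZ, hXx, hYy, Finset.card_union_of_disjoint, Finset.card_union_of_disjoint,
      Finset.card_union_of_disjoint, hcX, hcY, hcL]
    · omega
    · rw [Finset.disjoint_left]
      intro v h1 h2
      exact hd v (Or.inr (by simpa using h1)) h2
    · rw [Finset.disjoint_right]
      intro v h1 h2
      simp only [List.mem_toFinset, Finset.mem_union] at h1 h2
      rcases h2 with h2 | h2
      · exact hXYL v (Or.inl h1) v h2 rfl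
      · exact hd v (Or.inl (Or.inl h1)) h2
    · rw [Finset.disjoint_right]
      intro v h1 h2
      simp only [List.mem_toFinset, Finset.mem_union] at h1 h2
      rcases h2 with (h2 | h2) | h2
      · exact hXYL v (Or.inr h1) v h2 rfl
      · exact hd v (Or.inl (Or.inr h1)) h2
      · exact hXY v h2 v h1 rfl
  refine (Finset.sum_congr rfl fun τ hτ => ?_).trans
    (_root_.sum_transversal_eq_zero (p := p) (h := weight G Z) (Z := Z) (m := k - 1)
      (fun Y hY hYc => hT.sum_weight_eq_zero hG hS (by omega) hZS hY (by omega) hZc)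
      (Finset.range n) x y hxinj hyinj
      (fun i hi j hj => hXY _ (hmemX i hi) _ (hmemY j hj)) L.toFinset Q
      (fun i hi h => hXYL _ (Or.inl (hmemX i hi)) _ (by simpa using h) rfl)
      (fun i hi h => hXYL _ (Or.inr (hmemY i hi)) _ (by simpa using h) rfl)
      (fun i hi => hd _ (Or.inl (Or.inl (hmemX i hi))))
      (fun i hi => hd _ (Or.inl (Or.inr (hmemY i hi))))
      (fun v hv => hd v (Or.inr (by simpa using hv))) hZ (by omega) hQ
      (by rw [hcL, Finset.card_range]; omega))
  rw [Finset.mem_powerset] at hτ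
  have hpX := subseqC_append_subseq_perm 0 X τ
  have hpY := subseqC_append_subseq_perm 0 Y τ
  have hlen : (subseq 0 Y τ).length = (subseq 0 X τ).length :=
    length_subseq_congr (hY.trans hX.symm)
  have hlenX := hpX.length_eq
  have hl1 : (subseqC 0 X τ ++ subseq 0 Y τ ++ L).length + 1 = k := by
    simp only [List.length_append] at hlenX ⊢
    omega
  have hl2 : (subseqC 0 X τ ++ subseq 0 Y τ ++ L).Nodup :=
    hnd.sublist (((subseqC_sublist 0 X τ).append (subseq_sublist 0 Y τ)).append_right L)
  have hset : L.toFinset ∪ ((Finset.range n \ τ).image x ∪ τ.image y) =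
      (subseqC 0 X τ ++ subseq 0 Y τ ++ L).toFinset := by
    rw [List.toFinset_append, List.toFinset_append, toFinset_subseqC,
      toFinset_subseq (by rwa [hY]), hX, Finset.union_comm]
  have hsubZ : (subseqC 0 X τ ++ subseq 0 Y τ ++ L).toFinset ⊆ Z := by
    intro v hv
    rw [hZ, hXx, hYy]
    simp only [Finset.mem_union, List.mem_toFinset, List.mem_append] at hv ⊢
    rcases hv with (h | h) | h
    · exact Or.inl (Or.inr ((subseqC_sublist 0 X τ).subset h))
    · exact Or.inr ((subseq_sublist 0 Y τ).subset h)
    · exact Or.inl (Or.inl (Or.inl h))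
  have hcomp : Z \ (subseqC 0 X τ ++ subseq 0 Y τ ++ L).toFinset =
      (subseq 0 X τ).toFinset ∪ (subseqC 0 Y τ).toFinset ∪ Q := by
    rw [hZ, hXx, hYy, ← List.toFinset_eq_of_perm _ _ hpX, ← List.toFinset_eq_of_perm _ _ hpY]
    refine sdiff_transversal ?_ fun v hv => hd v ?_
    · exact (((hpX.append hpY).append_right L).nodup_iff).2 hnd
    · simpa only [List.mem_append, ← hpX.mem_iff, ← hpY.mem_iff] using hv
  rw [hset, hG.weight_toFinset hl2 hl1, hcomp]
  rw [Finset.card_sdiff_of_subset hsubZ, List.toFinset_card_of_nodup hl2, hZc]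
  omega

end Transversals

/-- suppose `|S| = q + 2` (so `t = k − 3`), `p + 1 ≤ k ≤ 2p − 2`, `n = k − p`
and `M = {1,…,n}`.  For pairwise disjoint ordered subsequences `X = (x_1,…,x_n)`,
`Y = (y_1,…,y_n)`, `L` (size `p − 1`), `E` (size `2p − k − 2`) and `W = (w_1,…,w_{2n})` of
`S`, with `W_j = {w_1,…,w_j}`, for every `0 ≤ r ≤ n`:
`0 = ∑_{τ ⊆ M} (−1)^{|τ|+σ(X_τ,X)} P_{L∪X_{M∖τ}}(Y_τ, X_τ)
  ∏_{i=1}^{r} det(y_{n+1−i}, X_{M∖τ}, Y_τ, L)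
  ∏_{z ∈ E∪X_τ∪Y_{M∖τ}∪W_{n+r}} det(z, X_{M∖τ}, Y_τ, L)⁻¹`. -/
theorem statement13 (p h k q t n : ℕ) (hp : p.Prime) (hh : 1 ≤ h) (hq : q = p ^ h)
    (hk : 4 ≤ k)
    (F : Type) [Field F] [Fintype F] [DecidableEq F] (hF : Fintype.card F = q)
    (S : Finset (Fin k → F))
    (harc : ∀ A ⊆ S, A.card = k →
      LinearIndependent F (fun v : {x // x ∈ A} => (v : Fin k → F)) ∧
      Submodule.span F (A : Set (Fin k → F)) = ⊤)
    (ht : S.card + t = q + k - 1) (ht1 : 1 ≤ t) (hSk : k ≤ S.card)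
    (T : Finset (Fin k → F) → (Fin k → F) → F) (hT : IsTangentFamily t S T)
    (hS2 : S.card = q + 2)
    (hk1 : p + 1 ≤ k) (hk2 : k + 2 ≤ 2 * p) (hn : n + p = k)
    (X Y L E W : List (Fin k → F))
    (hX : X.length = n) (hY : Y.length = n) (hL : L.length + 1 = p)
    (hE : E.length + k + 2 = 2 * p) (hW : W.length = 2 * n)
    (hnd : (X ++ Y ++ L ++ E ++ W).Nodup)
    (hin : ∀ v ∈ X ++ Y ++ L ++ E ++ W, v ∈ S)
    (r : ℕ) (hr : r ≤ n) :
    0 = ∑ tau ∈ (Finset.range n).powerset,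
        (-1 : F) ^ (tau.card + (t + 1) * invCount tau n) *
          segreP T (L.toFinset ∪ (subseqC 0 X tau).toFinset)
            (subseq 0 Y tau) (subseq 0 X tau) *
          (∏ i ∈ Finset.range r,
            detCols (Y.getD (n - 1 - i) 0 :: (subseqC 0 X tau ++ subseq 0 Y tau ++ L))) *
          ∏ z ∈ E.toFinset ∪ (subseq 0 X tau).toFinset ∪ (subseqC 0 Y tau).toFinset ∪
              (W.take (n + r)).toFinset,
            (detCols (z :: (subseqC 0 X tau ++ subseq 0 Y tau ++ L)))⁻¹ := by
  have hS : IsVectorArc S := harc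
  have hFp : CharP F p := by
    have := Fact.mk hp
    exact charP_of_card_eq_prime_pow (hF.trans hq)
  have ht3 : t + 3 = k := by omega
  obtain ⟨G, hG⟩ := hT.exists_isScaling hS (by rw [hF]; exact ht) hSk (by omega)
  have hk0 : 0 < k := by omega
  -- The index set, the columns of the determinants and the constant coefficients.
  set l : Finset ℕ → List (Fin k → F) := fun τ => subseqC 0 X τ ++ subseq 0 Y τ ++ L with hl
  set B : Finset ℕ → Finset (Fin k → F) := fun τ =>
    E.toFinset ∪ (subseq 0 X τ).toFinset ∪ (subseqC 0 Y τ).toFinset with hB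
  set κ : Finset ℕ → F := fun τ =>
    (-1) ^ τ.card * (G (l τ) * ∏ z ∈ B τ, (detCols (z :: l τ))⁻¹) with hκ
  have hsub : ∀ l' : List (Fin k → F), l'.Sublist (X ++ Y ++ L ++ E ++ W) →
      l'.Nodup ∧ ∀ v ∈ l', v ∈ S := fun l' h =>
    ⟨hnd.sublist h, fun v hv => hin v (h.subset hv)⟩
  have hXYL : (X ++ Y ++ L).Sublist (X ++ Y ++ L ++ E ++ W) := by
    simp only [List.append_assoc]
    simp
  have hlX : ∀ τ, (l τ).Sublist (X ++ Y ++ L) := fun τ =>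
    ((subseqC_sublist 0 X τ).append (subseq_sublist 0 Y τ)).append_right L
  have hXτ : ∀ τ, (subseqC 0 X τ ++ subseq 0 X τ).Perm X := subseqC_append_subseq_perm 0 X
  have hYX : ∀ τ, (subseq 0 Y τ).length = (subseq 0 X τ).length := fun τ =>
    length_subseq_congr (hY.trans hX.symm)
  have hlen : ∀ τ, (l τ).length + 1 = k := by
    intro τ
    have h1 := (hXτ τ).length_eq
    have h2 := hYX τ
    simp only [hl, List.length_append] at h1 ⊢
    omega
  have hBmem : ∀ τ, ∀ v ∈ B τ, v ∈ X ++ Y ++ L ++ E := by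
    intro τ v hv
    simp only [hB, Finset.mem_union, List.mem_toFinset, List.mem_append] at hv ⊢
    rcases hv with (h | h) | h
    · exact Or.inr h
    · exact Or.inl (Or.inl (Or.inl ((subseq_sublist 0 X τ).subset h)))
    · exact Or.inl (Or.inl (Or.inr ((subseqC_sublist 0 Y τ).subset h)))
  have hndX := (hsub _ hXYL).1
  have hndE : E.Nodup :=
    (hsub E ((List.sublist_append_right _ E).trans (List.sublist_append_left _ W))).1
  have hLS := hsub L ((List.sublist_append_right _ L).trans hXYL)
  have hEX : ∀ v ∈ X ++ Y ++ L, v ∉ E := by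
    intro v h1 h2
    have := (hsub (X ++ Y ++ L ++ E) (by simp)).1
    exact (List.nodup_append'.1 this).2.2 h1 h2
  set U : Finset (Fin k → F) := S \ (X ++ Y ++ L ++ E).toFinset with hU
  have hUmem : ∀ v ∈ U, v ∈ S ∧ v ∉ X ++ Y ++ L ++ E := by
    intro v hv
    rw [hU, Finset.mem_sdiff, List.mem_toFinset] at hv
    exact hv
  have hvanish := sum_prod_mul_prod_inv_eq_zero (Finset.range n).powerset κ
    (fun τ z => detCols (z :: l τ)) U n ?_ ?_ ?_ r (fun i => Y.getD (n - 1 - i) 0)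
    (W.take (n + r)).toFinset ?_ ?_
  · have hG0 : G (X ++ L) ≠ 0 := by
      have h1 := hsub (X ++ L) (((List.sublist_append_left X Y).append_right L).trans hXYL)
      exact hT.scaling_ne_zero hG (by simp; omega) (by omega) h1.1 h1.2
    symm
    rw [← zero_div (G (X ++ L)), ← hvanish, Finset.sum_div]
    refine Finset.sum_congr rfl fun τ _ => ?_
    have hperm : (subseq 0 Y τ ++ subseq 0 X τ ++ subseqC 0 X τ ++ L).Subperm (X ++ Y ++ L) := by
      have h1 : (subseq 0 Y τ ++ subseq 0 X τ ++ subseqC 0 X τ ++ L).Perm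
          (subseqC 0 X τ ++ subseq 0 X τ ++ subseq 0 Y τ ++ L) := by
        refine List.Perm.append_right L ?_
        rw [List.append_assoc]
        exact List.perm_append_comm.trans (List.perm_append_comm.append_right _)
      have h2 := ((hXτ τ).append_right (subseq 0 Y τ)).append_right L
      exact (h1.trans h2).subperm.trans
        (((subseq_sublist 0 Y τ).append_left X).append_right L).subperm
    have hnodup : (subseq 0 Y τ ++ subseq 0 X τ ++ subseqC 0 X τ ++ L).Nodup := by
      obtain ⟨l', h1, h2⟩ := hperm
      exact h1.nodup_iff.1 (hndX.sublist h2)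
    have hsegre := hT.segreP_eq hG (hYX τ) (P := subseqC 0 X τ) (R := L)
      (by have := hlen τ; simpa [hl, add_assoc] using this) (by omega)
      hnodup (fun v hv => (hsub _ hXYL).2 v (hperm.subset hv)) rfl
    rw [hsegre, hG.subseqC_append_subseq X L τ (by omega), hX, Finset.prod_union]
    · have hsgn : ((-1 : F) ^ ((t + 1) * invCount τ n)) ≠ 0 := pow_ne_zero _ (by simp)
      simp only [hκ, hl, hB, pow_add]
      field_simp
    · rw [Finset.disjoint_left]
      intro v h1 h2
      have h3 := List.mem_of_mem_take (List.mem_toFinset.1 h2)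
      exact (List.nodup_append'.1 hnd).2.2 (hBmem τ v h1) h3
  · intro τ _ b hb
    obtain ⟨h1, h2⟩ := hUmem b hb
    have h3 := hsub (l τ) ((hlX τ).trans hXYL)
    refine hS.detCols_ne_zero (by simpa using hlen τ) (List.nodup_cons.2 ⟨fun h => h2 ?_, h3.1⟩)
      (List.forall_mem_cons.2 ⟨h1, h3.2⟩)
    exact List.mem_append_left E ((hlX τ).subset h)
  · intro Q hQ hQc v
    have hdis : Disjoint Q L.toFinset := by
      rw [Finset.disjoint_left]
      intro w h1 h2
      exact (hUmem w (hQ h1)).2 (by simp only [List.mem_append]; simp at h2; tauto)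
    have hspan := (hS (Q ∪ L.toFinset)
      (Finset.union_subset (fun w hw => (hUmem w (hQ hw)).1)
        (fun w hw => hLS.2 w (by simpa using hw)))
      (by rw [Finset.card_union_of_disjoint hdis, hQc, List.toFinset_card_of_nodup hLS.1]; omega)).2
    have hv : v ∈ Submodule.span F ((Q ∪ L.toFinset : Finset (Fin k → F)) : Set (Fin k → F)) := by
      rw [hspan]
      trivial
    obtain ⟨c, -, hc⟩ := Submodule.mem_span_finset.1 hv
    refine ⟨c, fun τ _ => ?_⟩
    simp only [← detForm_apply hk0]
    rw [← hc, map_sum, Finset.sum_union hdis, add_eq_left.2]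
    · simp
    · refine Finset.sum_eq_zero fun w hw => ?_
      rw [map_smul, detForm_apply, detCols_eq_zero_of_mem _ (hlen τ).le, smul_zero]
      simp only [hl, List.mem_append]
      exact Or.inr (by simpa using hw)
  · intro Q hQ hQc
    have hEQ : Disjoint E.toFinset Q := by
      rw [Finset.disjoint_right]
      intro w h1 h2
      exact (hUmem w (hQ h1)).2 (List.mem_append_right _ (by simpa using h2))
    have hbase := hT.sum_transversal_eq_zero hG hS (p := p) (Q := E.toFinset ∪ Q) ht3 hn hX hY hL
      (by rw [Finset.card_union_of_disjoint hEQ, hQc, List.toFinset_card_of_nodup hndE]; omega)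
      hndX (hsub _ hXYL).2
      (Finset.union_subset (fun w hw => hin w (by simp at hw; simp [hw]))
        (fun w hw => (hUmem w (hQ hw)).1))
      (fun w h1 h2 => by
        rcases Finset.mem_union.1 h2 with h2 | h2
        · exact hEX w h1 (by simpa using h2)
        · exact (hUmem w (hQ h2)).2 (List.mem_append_left _ h1))
    rw [← hbase]
    refine Finset.sum_congr rfl fun τ _ => ?_
    have hdis : Disjoint (B τ) Q := by
      rw [Finset.disjoint_left]
      intro w h1 h2
      exact (hUmem w (hQ h2)).2 (hBmem τ w h1)
    have hunion : (subseq 0 X τ).toFinset ∪ (subseqC 0 Y τ).toFinset ∪ (E.toFinset ∪ Q) =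
        B τ ∪ Q := by
      rw [hB]
      ext
      simp only [Finset.mem_union]
      tauto
    rw [hunion, Finset.prod_union hdis, hκ]
    ring
  · intro w hw
    have h1 := List.mem_of_mem_take (List.mem_toFinset.1 hw)
    rw [hU, Finset.mem_sdiff, List.mem_toFinset]
    exact ⟨hin w (List.mem_append_right _ h1),
      fun h => (List.nodup_append'.1 hnd).2.2 h h1⟩
  · have h1 := (hsub W (List.sublist_append_right _ W)).1
    rw [List.toFinset_card_of_nodup (h1.sublist (List.take_sublist _ _)), List.length_take]
    omega
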